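/- arXiv:math/0610420 — 2 statements merged into one kernel-verified Lean document; each statement's English description precedes it below -/
import Mathlib

section
/- Let K be a Namioka–Phelps compact space. Then there is a norm on the Banach space C(K) of continuous real-valued functions on K, equivalent to the supremum norm, which is locally uniformly convex. -/
open Filter Topology

/-- `d` is a metric on `K` (as a bare distance function). -/
structure IsMetricOn (K : Type*) (d : K → K → ℝ) : Prop where
  self_eq_zero : ∀ x, d x x = 0
  eq_of_dist_eq_zero : ∀ x y, d x y = 0 → x = y
  symm : ∀ x y, d x y = d y x
  triangle : ∀ x y z, d x z ≤ d x y + d y z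

/-- The topology `T_d` induced by the distance function `d`: generated by open balls. -/
def metricTopology {K : Type*} (d : K → K → ℝ) : TopologicalSpace K :=
  TopologicalSpace.generateFrom {S | ∃ (x : K) (ε : ℝ), 0 < ε ∧ S = {y | d x y < ε}}

/-- Property `P(d,T)`: there is a sequence `(B_n)` of subsets of `K` such that the
topology generated by `T ∪ {B_n : n ∈ ℕ}` is finer than the metric topology `T_d`. -/
def PropertyP {K : Type*} (T : TopologicalSpace K) (d : K → K → ℝ) : Prop :=
  ∃ B : ℕ → Set K,
    TopologicalSpace.generateFrom ({U | T.IsOpen U} ∪ Set.range B) ≤ metricTopology d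

/-- The LUR hypothesis and conclusion at a point `x`, for a gauge `N`. -/
def LURAt {Z : Type*} [AddCommGroup Z] [Module ℝ Z] (N : Z → ℝ) (x : Z) : Prop :=
  ∀ xr : ℕ → Z,
    Tendsto (fun r => (1/2) * N x ^ 2 + (1/2) * N (xr r) ^ 2
        - N ((1/2 : ℝ) • (x + xr r)) ^ 2) atTop (nhds 0) →
    Tendsto (fun r => N (x - xr r)) atTop (nhds 0)

/-- `N` is a norm on the real vector space `Z`. -/
def IsNorm {Z : Type*} [AddCommGroup Z] [Module ℝ Z] (N : Z → ℝ) : Prop :=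
  (∀ z, 0 ≤ N z) ∧ (∀ z, N z = 0 → z = 0) ∧
    (∀ (c : ℝ) (z : Z), N (c • z) = |c| * N z) ∧
    ∀ z w, N (z + w) ≤ N z + N w

/-! ### Quadratic-type functionals -/

section QClass

set_option linter.unusedSectionVars false

variable {X : Type*} [NormedAddCommGroup X] [NormedSpace ℝ X]

/-- Squares of nonnegative sublinear functionals, with a uniform bound. -/
structure IsQ (Q : X → ℝ) : Prop where
  nonneg : ∀ f, 0 ≤ Q f
  smul : ∀ a : ℝ, 0 ≤ a → ∀ f, Q (a • f) = a ^ 2 * Q f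
  add : ∀ s : ℝ, 0 < s → ∀ f g, Q (f + g) ≤ (1 + s) * Q f + (1 + s⁻¹) * Q g
  bound : ∀ f, Q f ≤ 19 * ‖f‖ ^ 2

/-- The midpoint defect of a functional. -/
noncomputable def defect (Q : X → ℝ) (f g : X) : ℝ :=
  (1/2) * Q f + (1/2) * Q g - Q ((1/2 : ℝ) • (f + g))

lemma sqrt_add_of {Q : X → ℝ} (h0 : ∀ f, 0 ≤ Q f)
    (hadd : ∀ s : ℝ, 0 < s → ∀ f g, Q (f + g) ≤ (1 + s) * Q f + (1 + s⁻¹) * Q g) (f g : X) :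
    √(Q (f + g)) ≤ √(Q f) + √(Q g) := by
  set a := √(Q f) with ha
  set b := √(Q g) with hb
  have ha0 : 0 ≤ a := Real.sqrt_nonneg _
  have hb0 : 0 ≤ b := Real.sqrt_nonneg _
  have ha2 : Q f = a ^ 2 := (Real.sq_sqrt (h0 f)).symm
  have hb2 : Q g = b ^ 2 := (Real.sq_sqrt (h0 g)).symm
  refine le_of_forall_pos_le_add ?_
  intro e he
  have h := hadd ((b + e/2) / (a + e/2)) (by positivity) f g
  rw [ha2, hb2] at h
  have hA : 0 < a + e/2 := by positivity
  have hB : 0 < b + e/2 := by positivity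
  have h2 : (1 + (b + e/2) / (a + e/2)) * a ^ 2 + (1 + ((b + e/2) / (a + e/2))⁻¹) * b ^ 2
      ≤ (a + b + e) ^ 2 := by
    have e1 : (1 + (b + e/2) / (a + e/2)) * a ^ 2 ≤
        (1 + (b + e/2) / (a + e/2)) * (a + e/2) ^ 2 := by
      gcongr; linarith
    have e2 : (1 + ((b + e/2) / (a + e/2))⁻¹) * b ^ 2 ≤
        (1 + ((b + e/2) / (a + e/2))⁻¹) * (b + e/2) ^ 2 := by
      gcongr; linarith
    have e3 : (1 + (b + e/2) / (a + e/2)) * (a + e/2) ^ 2 +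
        (1 + ((b + e/2) / (a + e/2))⁻¹) * (b + e/2) ^ 2 = (a + b + e) ^ 2 := by
      field_simp
      ring
    linarith
  apply Real.sqrt_le_iff.2
  exact ⟨by positivity, h.trans h2⟩

namespace IsQ

lemma sqrt_add {Q : X → ℝ} (hQ : IsQ Q) (f g : X) : √(Q (f + g)) ≤ √(Q f) + √(Q g) :=
  sqrt_add_of hQ.nonneg hQ.add f g

lemma half {Q : X → ℝ} (hQ : IsQ Q) (f g : X) :
    Q ((1/2 : ℝ) • (f + g)) ≤ ((√(Q f) + √(Q g)) / 2) ^ 2 := by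
  rw [hQ.smul _ (by norm_num)]
  have h := hQ.sqrt_add f g
  have h1 : Q (f + g) ≤ (√(Q f) + √(Q g)) ^ 2 := by
    rw [← Real.sq_sqrt (hQ.nonneg (f + g))]
    gcongr
  linarith

lemma defect_ge {Q : X → ℝ} (hQ : IsQ Q) (f g : X) :
    (1/4) * (√(Q f) - √(Q g)) ^ 2 ≤ defect Q f g := by
  have h := hQ.half f g
  have h1 := Real.sq_sqrt (hQ.nonneg f)
  have h2 := Real.sq_sqrt (hQ.nonneg g)
  unfold defect
  nlinarith

lemma defect_nonneg {Q : X → ℝ} (hQ : IsQ Q) (f g : X) : 0 ≤ defect Q f g :=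
  le_trans (by positivity) (hQ.defect_ge f g)

lemma of_sublinear {p : X → ℝ} (h0 : ∀ f, 0 ≤ p f)
    (hs : ∀ a : ℝ, 0 ≤ a → ∀ f, p (a • f) = a * p f)
    (ha : ∀ f g, p (f + g) ≤ p f + p g) (hb : ∀ f, p f ≤ 3 * ‖f‖) :
    IsQ (fun f => p f ^ 2) where
  nonneg f := by positivity
  smul a ha f := by simp only [hs a ha]; ring
  add s hs f g := by
    have h1 : p (f + g) ^ 2 ≤ (p f + p g) ^ 2 := by
      have := h0 (f + g); have := ha f g; gcongr
    have h2 : 0 ≤ s⁻¹ * (s * p f - p g) ^ 2 := by positivity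
    have h3 : s⁻¹ * (s * p f - p g) ^ 2 = s * p f ^ 2 - 2 * p f * p g + s⁻¹ * p g ^ 2 := by
      field_simp
      ring
    nlinarith
  bound f := by
    have := h0 f; have := hb f
    have h1 : p f ^ 2 ≤ (3 * ‖f‖) ^ 2 := by gcongr
    nlinarith [sq_nonneg ‖f‖]

lemma bddAbove {ι : Sort*} {Q : ι → X → ℝ} (hQ : ∀ i, IsQ (Q i)) (f : X) :
    BddAbove (Set.range fun i => Q i f) :=
  ⟨19 * ‖f‖ ^ 2, by rintro _ ⟨i, rfl⟩; exact (hQ i).bound f⟩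

lemma iSup {ι : Sort*} {Q : ι → X → ℝ} (hQ : ∀ i, IsQ (Q i)) :
    IsQ (fun f => ⨆ i, Q i f) where
  nonneg f := Real.iSup_nonneg fun i => (hQ i).nonneg f
  smul a ha f := by
    simp only [fun i => (hQ i).smul a ha f]
    rw [Real.mul_iSup_of_nonneg (by positivity)]
  add s hs f g := by
    have hf : 0 ≤ ⨆ i, Q i f := Real.iSup_nonneg fun i => (hQ i).nonneg f
    have hg : 0 ≤ ⨆ i, Q i g := Real.iSup_nonneg fun i => (hQ i).nonneg g
    refine Real.iSup_le (fun i => ?_) (by positivity)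
    refine ((hQ i).add s hs f g).trans ?_
    have h1 := le_ciSup (bddAbove hQ f) i
    have h2 := le_ciSup (bddAbove hQ g) i
    gcongr
  bound f := Real.iSup_le (fun i => (hQ i).bound f) (by positivity)

lemma comb {Q₁ Q₂ : X → ℝ} (h₁ : IsQ Q₁) (h₂ : IsQ Q₂) {a b : ℝ} (ha : 0 ≤ a) (hb : 0 ≤ b)
    (hab : a + b ≤ 1) : IsQ (fun f => a * Q₁ f + b * Q₂ f) where
  nonneg f := by have := h₁.nonneg f; have := h₂.nonneg f; positivity
  smul c hc f := by simp only [h₁.smul c hc, h₂.smul c hc]; ring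
  add s hs f g := by
    have e1 := mul_le_mul_of_nonneg_left (h₁.add s hs f g) ha
    have e2 := mul_le_mul_of_nonneg_left (h₂.add s hs f g) hb
    linarith
  bound f := by
    have e1 := mul_le_mul_of_nonneg_left (h₁.bound f) ha
    have e2 := mul_le_mul_of_nonneg_left (h₂.bound f) hb
    have e3 : (a + b) * (19 * ‖f‖ ^ 2) ≤ 1 * (19 * ‖f‖ ^ 2) := by gcongr
    linarith

lemma mean {ι : Type*} {Q : ι → X → ℝ} (hQ : ∀ i, IsQ (Q i)) (A : Finset ι) (k : ℕ)
    (hk : A.card = k) : IsQ (fun f => (1 / (k : ℝ)) * ∑ i ∈ A, Q i f) where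
  nonneg f := mul_nonneg (by positivity) (Finset.sum_nonneg fun i _ => (hQ i).nonneg f)
  smul c hc f := by
    simp only [fun i => (hQ i).smul c hc f, ← Finset.mul_sum]; ring
  add s hs f g := by
    have : ∑ i ∈ A, Q i (f + g) ≤ (1 + s) * ∑ i ∈ A, Q i f + (1 + s⁻¹) * ∑ i ∈ A, Q i g := by
      rw [Finset.mul_sum, Finset.mul_sum, ← Finset.sum_add_distrib]
      exact Finset.sum_le_sum fun i _ => (hQ i).add s hs f g
    have := mul_le_mul_of_nonneg_left this (show (0:ℝ) ≤ 1 / (k:ℝ) by positivity)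
    linarith
  bound f := by
    have : ∑ i ∈ A, Q i f ≤ k * (19 * ‖f‖ ^ 2) := by
      have := Finset.sum_le_card_nsmul A (fun i => Q i f) (19 * ‖f‖ ^ 2)
        (fun i _ => (hQ i).bound f)
      rw [hk, nsmul_eq_mul] at this
      exact this
    have h2 := mul_le_mul_of_nonneg_left this (show (0:ℝ) ≤ 1 / (k:ℝ) by positivity)
    refine h2.trans ?_
    rcases Nat.eq_zero_or_pos k with h | h
    · subst h; simp
    · have : (0:ℝ) < k := by exact_mod_cast h
      rw [← mul_assoc, one_div, inv_mul_cancel₀ this.ne', one_mul]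

end IsQ

lemma tendsto_sqrt_of_defect {Q : X → ℝ} (hQ : IsQ Q) {f : X} {fr : ℕ → X}
    (h : Tendsto (fun r => defect Q f (fr r)) atTop (𝓝 0)) :
    Tendsto (fun r => √(Q (fr r))) atTop (𝓝 (√(Q f))) := by
  have h1 : Tendsto (fun r => 2 * √(defect Q f (fr r))) atTop (𝓝 0) := by
    have := (h.sqrt).const_mul 2
    simpa using this
  rw [tendsto_iff_dist_tendsto_zero]
  refine squeeze_zero (fun _ => dist_nonneg) (fun r => ?_) h1
  have h2 := hQ.defect_ge f (fr r)
  rw [Real.dist_eq, abs_sub_comm, ← Real.sqrt_sq_eq_abs]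
  have : (√(Q f) - √(Q (fr r))) ^ 2 ≤ 4 * defect Q f (fr r) := by linarith
  calc √((√(Q f) - √(Q (fr r))) ^ 2) ≤ √(4 * defect Q f (fr r)) := Real.sqrt_le_sqrt this
    _ = 2 * √(defect Q f (fr r)) := by
      rw [Real.sqrt_mul (by norm_num)]
      congr 1
      rw [show (4:ℝ) = 2 ^ 2 by norm_num]
      exact Real.sqrt_sq (by norm_num)

lemma gap_lemma {ι : Sort*} {Q : ι → X → ℝ} (hQ : ∀ i, IsQ (Q i)) {f : X} {fr : ℕ → X}
    (h : Tendsto (fun r => defect (fun g => ⨆ i, Q i g) f (fr r)) atTop (𝓝 0))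
    (i0 : ι) {κ : ℝ} (hκ : 0 < κ) (hgap : ∀ i, i ≠ i0 → Q i f ≤ Q i0 f - κ) :
    Tendsto (fun r => defect (Q i0) f (fr r)) atTop (𝓝 0) := by
  set S : X → ℝ := fun g => ⨆ i, Q i g with hS
  have hSQ : IsQ S := IsQ.iSup hQ
  have hle : ∀ i g, Q i g ≤ S g := fun i g => le_ciSup (IsQ.bddAbove hQ g) i
  have : Nonempty ι := ⟨i0⟩
  have hex : ∀ r : ℕ, ∃ i, S ((1/2:ℝ) • (f + fr r)) - 1 / ((r:ℝ) + 1)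
      < Q i ((1/2:ℝ) • (f + fr r)) := fun r =>
    exists_lt_of_lt_ciSup (by
      have : (0:ℝ) < 1 / ((r:ℝ) + 1) := by positivity
      change _ < S _
      linarith)
  choose i hi using hex
  have hone : Tendsto (fun r : ℕ => 1 / ((r:ℝ) + 1)) atTop (𝓝 0) :=
    tendsto_one_div_add_atTop_nhds_zero_nat
  set e : ℕ → ℝ := fun r => defect S f (fr r) + 1 / ((r:ℝ) + 1) with he
  have he0 : Tendsto e atTop (𝓝 0) := by
    have := h.add hone
    rwa [add_zero] at this
  have hde : ∀ r, defect (Q (i r)) f (fr r) ≤ e r := by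
    intro r
    have h1 := hle (i r) f
    have h2 := hle (i r) (fr r)
    have h3 := hi r
    simp only [he, defect]
    linarith
  have hSr := tendsto_sqrt_of_defect hSQ h
  have hSh : Tendsto (fun r => S ((1/2:ℝ) • (f + fr r)) - 1 / ((r:ℝ) + 1)) atTop (𝓝 (S f)) := by
    have h1 : Tendsto (fun r => (1/2) * S f + (1/2) * (√(S (fr r))) ^ 2 - defect S f (fr r)
        - 1 / ((r:ℝ) + 1)) atTop (𝓝 ((1/2) * S f + (1/2) * (√(S f)) ^ 2 - 0 - 0)) :=
      ((tendsto_const_nhds.add ((hSr.pow 2).const_mul _)).sub h).sub hone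
    rw [Real.sq_sqrt (hSQ.nonneg f)] at h1
    convert h1 using 2
    · rw [Real.sq_sqrt (hSQ.nonneg _)]
      simp only [defect]; ring
    · ring
  have hy : Tendsto (fun r => S f - κ + 2 * √(S f) * √(e r) + e r) atTop (𝓝 (S f - κ)) := by
    have := (tendsto_const_nhds (x := S f - κ)).add ((he0.sqrt).const_mul (2 * √(S f)))
    have := this.add he0
    simpa using this
  have hev := hy.eventually_lt hSh (by linarith)
  have hfin : ∀ᶠ r in atTop, i r = i0 := by
    filter_upwards [hev] with r hr
    by_contra hne
    have h1 := hgap _ hne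
    have h2 := hle i0 f
    have h3 := (hQ (i r)).half f (fr r)
    have h4 := (hQ (i r)).defect_ge f (fr r)
    have h5 := hde r
    have h6 := hi r
    have he' : 0 ≤ e r := le_trans (((hQ (i r)).defect_nonneg f (fr r))) h5
    set a := √(Q (i r) f) with ha
    set b := √(Q (i r) (fr r)) with hb
    have ha0 : 0 ≤ a := Real.sqrt_nonneg _
    have hb0 : 0 ≤ b := Real.sqrt_nonneg _
    have haS : a ≤ √(S f) := Real.sqrt_le_sqrt (hle _ _)
    have hsq := Real.sq_sqrt he'
    have hse : 0 ≤ √(e r) := Real.sqrt_nonneg _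
    have ha2 : a ^ 2 = Q (i r) f := Real.sq_sqrt ((hQ _).nonneg _)
    have hab : b - a ≤ 2 * √(e r) := by
      refine (abs_le_of_sq_le_sq' ?_ (by positivity)).2
      nlinarith
    have h7 : ((a + b) / 2) ^ 2 ≤ (a + √(e r)) ^ 2 := by
      apply pow_le_pow_left₀ (by positivity)
      linarith
    have h8 : a * √(e r) ≤ √(S f) * √(e r) := by gcongr
    nlinarith
  refine squeeze_zero' (Eventually.of_forall fun r => (hQ i0).defect_nonneg _ _) ?_ he0
  filter_upwards [hfin] with r hr
  have := hde r
  rwa [hr] at this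

lemma defect_comb_tendsto {Q₁ Q₂ : X → ℝ} (h₁ : IsQ Q₁) (h₂ : IsQ Q₂) {a b : ℝ} (ha : 0 ≤ a)
    (hb : 0 < b) {f : X} {fr : ℕ → X}
    (h : Tendsto (fun r => defect (fun g => a * Q₁ g + b * Q₂ g) f (fr r)) atTop (𝓝 0)) :
    Tendsto (fun r => defect Q₂ f (fr r)) atTop (𝓝 0) := by
  have h' : Tendsto (fun r => b⁻¹ * defect (fun g => a * Q₁ g + b * Q₂ g) f (fr r))
      atTop (𝓝 0) := by simpa using h.const_mul b⁻¹
  refine squeeze_zero (fun r => h₂.defect_nonneg _ _) (fun r => ?_) h'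
  have h1 := h₁.defect_nonneg f (fr r)
  have h2 : defect (fun g => a * Q₁ g + b * Q₂ g) f (fr r)
      = a * defect Q₁ f (fr r) + b * defect Q₂ f (fr r) := by
    simp only [defect]; ring
  rw [h2, mul_add, ← mul_assoc b⁻¹ b, inv_mul_cancel₀ hb.ne', one_mul]
  have : 0 ≤ b⁻¹ * (a * defect Q₁ f (fr r)) := by positivity
  linarith

end QClass

/-! ### Strategies and the associated functionals -/

universe u

/-- Finite strategies. -/
inductive Strat : Type
  | leaf : Strat
  | node (σ : Bool) (n k l : ℕ) (a b : Strat) : Strat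

/-- A numerical code of a strategy. -/
def Strat.code : Strat → ℕ
  | Strat.leaf => 0
  | Strat.node σ n k l a b => Nat.pair σ.toNat (Nat.pair n (Nat.pair k (Nat.pair l
      (Nat.pair a.code b.code)))) + 1

lemma Strat.code_injective : Function.Injective Strat.code := by
  intro x
  induction x with
  | leaf =>
    intro y h
    cases y with
    | leaf => rfl
    | node => simp [Strat.code] at h
  | node σ n k l a b iha ihb =>
    intro y h
    cases y with
    | leaf => simp [Strat.code] at h
    | node σ₂ n₂ k₂ l₂ a₂ b₂ =>
      simp only [Strat.code, Nat.add_right_cancel_iff, Nat.pair_eq_pair] at h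
      obtain ⟨h1, rfl, rfl, rfl, h2, h3⟩ := h
      rw [iha h2, ihb h3]
      cases σ <;> cases σ₂ <;> simp_all

noncomputable instance : Encodable Strat := by
  have : Countable Strat := Strat.code_injective.countable
  exact Encodable.ofCountable Strat

/-- A sign. -/
noncomputable def sgn (σ : Bool) : ℝ := if σ then 1 else -1

lemma abs_sgn (σ : Bool) : |sgn σ| = 1 := by cases σ <;> simp [sgn]

section Functionals

variable {K : Type u} [TopologicalSpace K] [CompactSpace K]

lemma sgn_mul_bound (σ : Bool) (f : C(K, ℝ)) (x : K) : |sgn σ * f x| ≤ ‖f‖ := by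
  rw [abs_mul, abs_sgn, one_mul]
  exact f.norm_coe_le_norm x

lemma isQ_point (σ : Bool) (x : K) : IsQ (fun f : C(K, ℝ) => (sgn σ * f x + 2 * ‖f‖) ^ 2) := by
  refine IsQ.of_sublinear (p := fun f : C(K, ℝ) => sgn σ * f x + 2 * ‖f‖) ?_ ?_ ?_ ?_
  · intro f
    have := (abs_le.1 (sgn_mul_bound σ f x)).1
    have := norm_nonneg f
    linarith
  · intro a ha f
    simp only [ContinuousMap.smul_apply, smul_eq_mul, norm_smul, Real.norm_of_nonneg ha]
    ring
  · intro f g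
    have := norm_add_le f g
    simp only [ContinuousMap.add_apply]
    linarith
  · intro f
    have := (abs_le.1 (sgn_mul_bound σ f x)).2
    linarith

/-- Supremum functional over a set. -/
noncomputable def supQ (σ : Bool) (S : Set K) (f : C(K, ℝ)) : ℝ :=
  ⨆ x : S, (sgn σ * f x + 2 * ‖f‖) ^ 2

lemma isQ_supQ (σ : Bool) (S : Set K) : IsQ (supQ σ S) :=
  IsQ.iSup fun x : S => isQ_point σ (x : K)

lemma le_sqrt_supQ (σ : Bool) {S : Set K} (f : C(K, ℝ)) {x : K} (hx : x ∈ S) :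
    sgn σ * f x + 2 * ‖f‖ ≤ √(supQ σ S f) := by
  apply Real.le_sqrt_of_sq_le
  exact le_ciSup (f := fun x : S => (sgn σ * f x + 2 * ‖f‖) ^ 2)
    (IsQ.bddAbove (fun x : S => isQ_point σ (x : K)) f) ⟨x, hx⟩

lemma point_nonneg (σ : Bool) (f : C(K, ℝ)) (x : K) : ‖f‖ ≤ sgn σ * f x + 2 * ‖f‖ := by
  have := (abs_le.1 (sgn_mul_bound σ f x)).1
  linarith

lemma supQ_le (σ : Bool) {S : Set K} (f : C(K, ℝ)) {b : ℝ} (hb : 0 ≤ b)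
    (h : ∀ x ∈ S, sgn σ * f x + 2 * ‖f‖ ≤ b) : supQ σ S f ≤ b ^ 2 := by
  refine Real.iSup_le (fun x => ?_) (by positivity)
  have := point_nonneg σ f x
  have := norm_nonneg f
  have := h x x.2
  gcongr
  linarith

/-- Leaf functional. -/
noncomputable def leafQ (F : Set K) (f : C(K, ℝ)) : ℝ :=
  (1/3) * (‖f‖ ^ 2) + (2/3) * ((1/2) * supQ true F f + (1/2) * supQ false F f)

lemma isQ_norm : IsQ (fun f : C(K, ℝ) => ‖f‖ ^ 2) := by
  refine IsQ.of_sublinear (p := fun f : C(K, ℝ) => ‖f‖) (fun f => norm_nonneg f) ?_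
    (fun f g => norm_add_le f g) ?_
  · intro a ha f
    simp only [norm_smul, Real.norm_of_nonneg ha]
  · intro f
    have := norm_nonneg f
    linarith

lemma isQ_leaf (F : Set K) : IsQ (leafQ F) :=
  isQ_norm.comb ((isQ_supQ true F).comb (isQ_supQ false F) (by norm_num) (by norm_num)
    (by norm_num)) (by norm_num) (by norm_num) (by norm_num)

variable (ρ : K → Ordinal.{u}) (H : ℕ → Set K) (R O : ℕ → Ordinal.{u} → Set K)

/-- The node summand attached to a finite set of ranks. -/
noncomputable def nodeQ (σ : Bool) (n k l : ℕ) (qa qb : Set K → C(K, ℝ) → ℝ) (F : Set K)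
    (A : Finset Ordinal.{u}) (f : C(K, ℝ)) : ℝ :=
  (1/2) * ((1 / (k:ℝ)) * ∑ ξ ∈ A, supQ σ (F ∩ H n ∩ {x | ρ x = ξ}) f) +
    ((1/2) * (1 / ((l:ℝ) + 1))) * ((1/2) * qa (F ∩ ⋃ ξ ∈ A, R n ξ) f
      + (1/2) * qb (F \ ⋃ ξ ∈ A, O n ξ) f)

lemma isQ_node (σ : Bool) (n k l : ℕ) {qa qb : Set K → C(K, ℝ) → ℝ}
    (ha : ∀ F, IsQ (qa F)) (hb : ∀ F, IsQ (qb F)) (F : Set K)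
    (A : Finset Ordinal.{u}) (hA : A.card = k) :
    IsQ (nodeQ ρ H R O σ n k l qa qb F A) := by
  refine IsQ.comb (IsQ.mean (fun ξ => isQ_supQ σ _) A k hA)
    ((ha _).comb (hb _) (by norm_num) (by norm_num) (by norm_num)) (by norm_num)
    (by positivity) ?_
  have : 1 / ((l:ℝ) + 1) ≤ 1 := by
    rw [div_le_one (by positivity)]
    have : (0:ℝ) ≤ l := by positivity
    linarith
  linarith

/-- The functional attached to a strategy and a set. -/
noncomputable def stratQ : Strat → Set K → C(K, ℝ) → ℝ
  | Strat.leaf => leafQ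
  | Strat.node σ n k l a b => fun F f => ⨆ A : {A : Finset Ordinal.{u} // A.card = k},
      nodeQ ρ H R O σ n k l (stratQ a) (stratQ b) F A f

lemma isQ_strat (τ : Strat) : ∀ F, IsQ (stratQ ρ H R O τ F) := by
  induction τ with
  | leaf => intro F; exact isQ_leaf F
  | node σ n k l a b iha ihb =>
    intro F
    exact IsQ.iSup fun A : {A : Finset Ordinal.{u} // A.card = k} =>
      isQ_node ρ H R O σ n k l iha ihb F A A.2

/-- Sets which can be resolved for the function `f`. -/
inductive Good (f : C(K, ℝ)) (η : ℝ) : Set K → Prop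
  | leaf (F : Set K) (c : ℝ) (h : ∀ x ∈ F, |f x - c| < η) : Good f η F
  | node (F : Set K) (σ : Bool) (n : ℕ) (t : ℝ) (A : Finset Ordinal.{u}) (V : Set K)
      (hV : IsOpen V) (h1 : ∀ x ∈ F ∩ H n, t ≤ sgn σ * f x → x ∈ V)
      (h2 : ∀ y ∈ V ∩ H n, ρ y ∈ A)
      (h3 : ∀ ξ ∈ A, ∃ x ∈ F ∩ H n, t ≤ sgn σ * f x ∧ ρ x = ξ)
      (ga : Good f η (F ∩ ⋃ ξ ∈ A, R n ξ)) (gb : Good f η (F \ ⋃ ξ ∈ A, O n ξ)) : Good f η F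

/-- The combinatorial datum. -/
structure IsDatum : Prop where
  closedH : ∀ n, IsClosed (H n)
  closedR : ∀ n ξ, IsClosed (R n ξ)
  openO : ∀ n ξ, IsOpen (O n ξ)
  OR : ∀ n ξ, O n ξ ⊆ R n ξ
  rank : ∀ n ξ, ∀ x ∈ R n ξ, ρ x ≤ ξ
  pick : ∀ P : Set K, IsClosed P → P.Nonempty → ∃ n, (P ∩ H n).Nonempty ∧
    ∀ x ∈ P ∩ H n, x ∈ O n (ρ x) ∧ ∃ U, IsOpen U ∧ x ∈ U ∧ ∀ y ∈ U ∩ H n, ρ y = ρ x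

variable {ρ H R O}

lemma Good.exists_open (hD : IsDatum ρ H R O) {f : C(K, ℝ)} {η : ℝ} {F : Set K}
    (hF : Good ρ H R O f η F) :
    ∃ W, IsOpen W ∧ F ⊆ W ∧ ∀ F', F ⊆ F' → F' ⊆ W → Good ρ H R O f η F' := by
  induction hF with
  | leaf F c h =>
    refine ⟨{x | |f x - c| < η}, isOpen_lt (by fun_prop) continuous_const, h, ?_⟩
    intro F' _ h'
    exact Good.leaf F' c h'
  | node F σ n t A V hV h1 h2 h3 ga gb iha ihb =>
    obtain ⟨W1, hW1, hF1, hg1⟩ := iha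
    obtain ⟨W2, hW2, hF2, hg2⟩ := ihb
    have hcR : IsClosed (⋃ ξ ∈ A, R n ξ) :=
      A.finite_toSet.isClosed_biUnion fun ξ _ => hD.closedR n ξ
    have hoO : IsOpen (⋃ ξ ∈ A, O n ξ) := isOpen_biUnion fun ξ _ => hD.openO n ξ
    refine ⟨((H n ∩ {x | t ≤ sgn σ * f x}) \ V)ᶜ ∩ ((⋃ ξ ∈ A, R n ξ) \ W1)ᶜ ∩
      ((⋃ ξ ∈ A, O n ξ)ᶜ \ W2)ᶜ, ?_, ?_, ?_⟩
    · refine ((isOpen_compl_iff.2 ?_).inter (isOpen_compl_iff.2 ?_)).inter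
        (isOpen_compl_iff.2 ?_)
      · exact ((hD.closedH n).inter (isClosed_le continuous_const (by fun_prop))).sdiff hV
      · exact hcR.sdiff hW1
      · exact hoO.isClosed_compl.sdiff hW2
    · intro x hx
      refine ⟨⟨?_, ?_⟩, ?_⟩
      · rintro ⟨⟨a, b⟩, c⟩
        exact c (h1 x ⟨hx, a⟩ b)
      · rintro ⟨a, b⟩
        exact b (hF1 ⟨hx, a⟩)
      · rintro ⟨a, b⟩
        exact b (hF2 ⟨hx, a⟩)
    · intro F' hFF' hF'
      refine Good.node F' σ n t A V hV ?_ h2 ?_ ?_ ?_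
      · intro x hx ht
        by_contra hxV
        exact (hF' hx.1).1.1 ⟨⟨hx.2, ht⟩, hxV⟩
      · intro ξ hξ
        obtain ⟨x, hx, h⟩ := h3 ξ hξ
        exact ⟨x, ⟨hFF' hx.1, hx.2⟩, h⟩
      · apply hg1
        · exact Set.inter_subset_inter_left _ hFF'
        · intro x hx
          by_contra hxW
          exact (hF' hx.1).1.2 ⟨hx.2, hxW⟩
      · apply hg2
        · exact Set.sdiff_subset_sdiff_left hFF'
        · intro x hx
          by_contra hxW
          exact (hF' hx.1).2 ⟨hx.2, hxW⟩

lemma all_good (hD : IsDatum ρ H R O) {f : C(K, ℝ)} {η : ℝ} (hη : 0 < η)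
    (hosc : ∀ x y, ρ x = ρ y → |f x - f y| ≤ η / 2) (ξ : Ordinal.{u}) :
    ∀ F : Set K, IsClosed F → (∀ x ∈ F, ρ x ≤ ξ) → Good ρ H R O f η F := by
  induction ξ using WellFoundedLT.induction with
  | ind ξ ih =>
  by_contra hcon
  push Not at hcon
  obtain ⟨F₀, hF₀c, hF₀r, hF₀b⟩ := hcon
  -- a minimal bad set
  obtain ⟨F, hFF₀, hmin⟩ := zorn_superset_nonempty
    {F : Set K | IsClosed F ∧ (∀ x ∈ F, ρ x ≤ ξ) ∧ ¬ Good ρ H R O f η F} (by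
      intro c hc hchain hne
      refine ⟨⋂₀ c, ⟨isClosed_sInter fun s hs => (hc hs).1, ?_, ?_⟩,
        fun s hs => Set.sInter_subset_of_mem hs⟩
      · intro x hx
        obtain ⟨s, hs⟩ := hne
        exact (hc hs).2.1 x (hx s hs)
      · intro hg
        obtain ⟨W, hW, hsub, hW'⟩ := hg.exists_open hD
        have hdir : DirectedOn (· ⊇ ·) c := by
          intro a ha b hb
          rcases hchain.total ha hb with h | h
          · exact ⟨a, ha, subset_rfl, h⟩
          · exact ⟨b, hb, h, subset_rfl⟩
        have : ∃ s ∈ c, s ⊆ W := by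
          have : Nonempty c := hne.to_subtype
          have hdir' : Directed (· ⊇ ·) (fun s : c => (s : Set K)) :=
            directedOn_iff_directed.1 hdir
          obtain ⟨s, hs⟩ := exists_subset_nhds_of_isCompact' hdir'
            (fun s => (hc s.2).1.isCompact) (fun s => (hc s.2).1) (U := W) (by
              intro x hx
              apply hW.mem_nhds
              apply hsub
              rw [Set.sInter_eq_iInter]
              exact hx)
          exact ⟨s, s.2, hs⟩
        obtain ⟨s, hs, hsW⟩ := this
        exact (hc hs).2.2 (hW' s (Set.sInter_subset_of_mem hs) hsW)) F₀ ⟨hF₀c, hF₀r, hF₀b⟩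
  obtain ⟨⟨hFc, hFr, hFb⟩, hminF⟩ := hmin
  apply hFb
  -- a central value
  obtain ⟨c, hc⟩ : ∃ c : ℝ, ∀ x, ρ x = ξ → |f x - c| ≤ η / 2 := by
    by_cases h : ∃ y, ρ y = ξ
    · obtain ⟨y, hy⟩ := h
      exact ⟨f y, fun x hx => hosc x y (hx.trans hy.symm)⟩
    · exact ⟨0, fun x hx => absurd ⟨x, hx⟩ h⟩
  by_cases hleaf : ∀ x ∈ F, |f x - c| < η
  · exact Good.leaf F c hleaf
  push Not at hleaf
  obtain ⟨x₀, hx₀, hx₀'⟩ := hleaf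
  obtain ⟨σ, hσ⟩ : ∃ σ : Bool, sgn σ * c + η ≤ sgn σ * f x₀ := by
    rcases le_abs.1 hx₀' with h | h
    · exact ⟨true, by simp only [sgn]; simp; linarith⟩
    · exact ⟨false, by simp only [sgn]; simp; linarith⟩
  set t := sgn σ * c + η with ht
  set P : Set K := F ∩ {x | t ≤ sgn σ * f x} with hP
  have hPc : IsClosed P := hFc.inter (isClosed_le continuous_const (by fun_prop))
  have hPr : ∀ x ∈ P, ρ x < ξ := by
    intro x hx
    refine lt_of_le_of_ne (hFr x hx.1) fun h => ?_
    have h1 := hc x h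
    have h2 : t ≤ sgn σ * f x := hx.2
    have h3 : |sgn σ * (f x - c)| ≤ η / 2 := by rw [abs_mul, abs_sgn, one_mul]; exact h1
    have := (abs_le.1 h3).2
    linarith
  obtain ⟨n, ⟨x₁, hx₁⟩, hn⟩ := hD.pick P hPc ⟨x₀, hx₀, hσ⟩
  have hcomp : IsCompact (P ∩ H n) := (hPc.inter (hD.closedH n)).isCompact
  choose! hnO U hU hxU hUr using hn
  obtain ⟨s, hs, hcov⟩ := hcomp.elim_nhds_subcover U
    (fun x hx => (hU x hx).mem_nhds (hxU x hx))
  set A : Finset Ordinal.{u} := s.image ρ with hA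
  have hAmem : ∀ ζ ∈ A, ∃ x ∈ P ∩ H n, ρ x = ζ := by
    intro ζ hζ
    obtain ⟨x, hx, rfl⟩ := Finset.mem_image.1 hζ
    exact ⟨x, hs x hx, rfl⟩
  have hV2 : ∀ y ∈ (⋃ x ∈ s, U x) ∩ H n, ρ y ∈ A := by
    rintro y ⟨hy, hyH⟩
    simp only [Set.mem_iUnion] at hy
    obtain ⟨x, hx, hyx⟩ := hy
    rw [hUr x (hs x hx) y ⟨hyx, hyH⟩]
    exact Finset.mem_image_of_mem _ hx
  have hcR : IsClosed (⋃ ξ ∈ A, R n ξ) :=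
    A.finite_toSet.isClosed_biUnion fun ξ _ => hD.closedR n ξ
  have hoO : IsOpen (⋃ ξ ∈ A, O n ξ) := isOpen_biUnion fun ξ _ => hD.openO n ξ
  have hx₁A : ρ x₁ ∈ A := hV2 x₁ ⟨hcov hx₁, hx₁.2⟩
  refine Good.node F σ n t A (⋃ x ∈ s, U x)
    (isOpen_biUnion fun x hx => hU x (hs x hx)) ?_ hV2 ?_ ?_ ?_
  · intro x hx hxt
    exact hcov ⟨⟨hx.1, hxt⟩, hx.2⟩
  · intro ζ hζ
    obtain ⟨x, hx, hxζ⟩ := hAmem ζ hζ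
    exact ⟨x, ⟨hx.1.1, hx.2⟩, hx.1.2, hxζ⟩
  · have hne : A.Nonempty := ⟨_, hx₁A⟩
    refine ih (A.max' hne) ?_ _ (hFc.inter hcR) ?_
    · obtain ⟨x, hx, hxζ⟩ := hAmem _ (A.max'_mem hne)
      rw [← hxζ]
      exact hPr x hx.1
    · rintro x ⟨_, hx⟩
      simp only [Set.mem_iUnion] at hx
      obtain ⟨ζ, hζ, hxζ⟩ := hx
      exact (hD.rank n ζ x hxζ).trans (A.le_max' ζ hζ)
  · by_contra hbad
    have := hminF (y := F \ ⋃ ξ ∈ A, O n ξ) ⟨hFc.sdiff hoO, fun x hx => hFr x hx.1, hbad⟩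
      Set.sdiff_subset hx₁.1.1
    apply this.2
    simp only [Set.mem_iUnion]
    exact ⟨ρ x₁, hx₁A, hnO x₁ hx₁⟩

lemma leaf_conclude {f : C(K, ℝ)} {η : ℝ} (hη : 0 < η) {F : Set K} {c : ℝ}
    (hc : ∀ x ∈ F, |f x - c| < η) {fr : ℕ → C(K, ℝ)}
    (h : Tendsto (fun r => defect (leafQ F) f (fr r)) atTop (𝓝 0)) :
    ∀ᶠ r in atTop, ∀ x ∈ F, |fr r x - f x| < 3 * η := by
  rcases F.eq_empty_or_nonempty with hF | ⟨x₀, hx₀⟩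
  · subst hF; simp
  have hQt := isQ_supQ (K := K) true F
  have hQf := isQ_supQ (K := K) false F
  have hmid := hQt.comb hQf (a := 1/2) (b := 1/2) (by norm_num) (by norm_num) (by norm_num)
  have hmid' := hQf.comb hQt (a := 1/2) (b := 1/2) (by norm_num) (by norm_num) (by norm_num)
  have d1 := defect_comb_tendsto isQ_norm hmid (a := 1/3) (b := 2/3) (by norm_num) (by norm_num) h
  have d2 := defect_comb_tendsto hQt hQf (a := 1/2) (b := 1/2) (by norm_num) (by norm_num) d1
  have d3 := defect_comb_tendsto hQf hQt (a := 1/2) (b := 1/2) (by norm_num) (by norm_num)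
    (f := f) (fr := fr) (by simpa only [add_comm] using d1)
  have d4 := defect_comb_tendsto hmid (isQ_norm (K := K)) (a := 2/3) (b := 1/3) (by norm_num)
    (by norm_num) (f := f) (fr := fr) (by
      refine h.congr fun r => ?_
      simp only [defect, leafQ]; ring)
  have t2 := tendsto_sqrt_of_defect hQf d2
  have t3 := tendsto_sqrt_of_defect hQt d3
  have t4 := tendsto_sqrt_of_defect (isQ_norm (K := K)) d4
  simp only [Real.sqrt_sq (norm_nonneg _)] at t4
  have key : ∀ σ : Bool, √(supQ σ F f) ≤ sgn σ * c + η + 2 * ‖f‖ := by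
    intro σ
    have h1 : ∀ x ∈ F, sgn σ * f x + 2 * ‖f‖ ≤ sgn σ * c + η + 2 * ‖f‖ := by
      intro x hx
      have h3 : |sgn σ * (f x - c)| < η := by rw [abs_mul, abs_sgn, one_mul]; exact hc x hx
      have := (abs_lt.1 h3).2
      linarith
    have h0 : 0 ≤ sgn σ * c + η + 2 * ‖f‖ :=
      ((norm_nonneg f).trans (point_nonneg σ f x₀)).trans (h1 x₀ hx₀)
    rw [Real.sqrt_le_left h0]
    exact supQ_le σ f h0 h1
  have e2 := t2.eventually_lt_const (show √(supQ false F f) < sgn false * c + η + 2 * ‖f‖ + η/2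
    by linarith [key false])
  have e3 := t3.eventually_lt_const (show √(supQ true F f) < sgn true * c + η + 2 * ‖f‖ + η/2
    by linarith [key true])
  have e4 := t4.eventually_const_lt (show ‖f‖ - η/8 < ‖f‖ by linarith)
  filter_upwards [e2, e3, e4] with r h2 h3 h4 x hx
  have k2 := le_sqrt_supQ false (fr r) hx
  have k3 := le_sqrt_supQ true (fr r) hx
  have k4 := abs_lt.1 (hc x hx)
  simp only [sgn] at h2 h3 k2 k3
  simp at h2 h3 k2 k3
  rw [abs_lt]
  constructor <;> linarith [k4.1, k4.2]

lemma Good.exists_strat (hD : IsDatum ρ H R O) {f : C(K, ℝ)} (hf : f ≠ 0) {η : ℝ} (hη : 0 < η)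
    {F : Set K} (hF : Good ρ H R O f η F) : IsClosed F →
    ∃ τ : Strat, ∀ fr : ℕ → C(K, ℝ),
      Tendsto (fun r => defect (stratQ ρ H R O τ F) f (fr r)) atTop (𝓝 0) →
      ∀ᶠ r in atTop, ∀ x ∈ F, |fr r x - f x| < 3 * η := by
  induction hF with
  | leaf F c h =>
    intro _
    exact ⟨Strat.leaf, fun fr hfr => leaf_conclude hη h hfr⟩
  | node F σ n t A V hV h1 h2 h3 ga gb iha ihb =>
    intro hFc
    have hcR : IsClosed (⋃ ξ ∈ A, R n ξ) :=
      A.finite_toSet.isClosed_biUnion fun ξ _ => hD.closedR n ξ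
    have hoO : IsOpen (⋃ ξ ∈ A, O n ξ) := isOpen_biUnion fun ξ _ => hD.openO n ξ
    obtain ⟨τa, hτa⟩ := iha (hFc.inter hcR)
    obtain ⟨τb, hτb⟩ := ihb (hFc.sdiff hoO)
    have hfpos : 0 < ‖f‖ := norm_pos_iff.2 hf
    -- the gap
    obtain ⟨δ, hδ, hgap⟩ : ∃ δ : ℝ, 0 < δ ∧ ∀ x ∈ F ∩ H n, ρ x ∉ A → sgn σ * f x ≤ t - δ := by
      have hcomp : IsCompact ((F ∩ H n) \ V) :=
        ((hFc.inter (hD.closedH n)).sdiff hV).isCompact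
      rcases ((F ∩ H n) \ V).eq_empty_or_nonempty with he | hne
      · refine ⟨1, one_pos, fun x hx hxA => ?_⟩
        have : x ∈ V := by
          by_contra hxV
          have : x ∈ (F ∩ H n) \ V := ⟨hx, hxV⟩
          rw [he] at this
          exact this
        exact absurd (h2 x ⟨this, hx.2⟩) hxA
      · obtain ⟨z, hz, hzmax⟩ := hcomp.exists_isMaxOn hne
          (f := fun x => sgn σ * f x) (by fun_prop)
        refine ⟨t - sgn σ * f z, ?_, fun x hx hxA => ?_⟩
        · have : ¬ t ≤ sgn σ * f z := fun h => hz.2 (h1 z hz.1 h)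
          linarith
        · have hxV : x ∉ V := fun hxV => hxA (h2 x ⟨hxV, hx.2⟩)
          have : sgn σ * f x ≤ sgn σ * f z := hzmax ⟨hx, hxV⟩
          linarith
    set s : Ordinal.{u} → ℝ := fun ξ => supQ σ (F ∩ H n ∩ {x | ρ x = ξ}) f with hs
    set b := max (t + 2 * ‖f‖) ‖f‖ with hb
    set δ' := min δ ‖f‖ with hδ'
    have hδ'0 : 0 < δ' := lt_min hδ hfpos
    have hbf : ‖f‖ ≤ b := le_max_right _ _
    have hδf : δ' ≤ ‖f‖ := min_le_right _ _
    have hin : ∀ ξ ∈ A, b ^ 2 ≤ s ξ := by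
      intro ξ hξ
      obtain ⟨x, hx, hxt, hxξ⟩ := h3 ξ hξ
      have k := le_sqrt_supQ σ f (S := F ∩ H n ∩ {x | ρ x = ξ}) ⟨hx, hxξ⟩
      have k2 := point_nonneg σ f x
      have k3 : b ≤ √(s ξ) := max_le (by linarith) (by linarith)
      have hb0 : 0 ≤ b := by linarith
      have e := Real.sq_sqrt ((isQ_supQ σ (F ∩ H n ∩ {x | ρ x = ξ})).nonneg f : 0 ≤ s ξ)
      calc b ^ 2 ≤ (√(s ξ)) ^ 2 := by gcongr
        _ = s ξ := e
    have hout : ∀ ξ, ξ ∉ A → s ξ ≤ (b - δ') ^ 2 := by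
      intro ξ hξ
      refine supQ_le σ f (by linarith) ?_
      rintro x ⟨hx, hxξ⟩
      have k := hgap x hx (by rw [show ρ x = ξ from hxξ]; exact hξ)
      have k2 : t + 2 * ‖f‖ ≤ b := le_max_left _ _
      have k3 : δ' ≤ δ := min_le_left _ _
      linarith
    set γ := b ^ 2 - (b - δ') ^ 2 with hγ
    have hγ0 : 0 < γ := by
      have : γ = δ' * (2 * b - δ') := by rw [hγ]; ring
      rw [this]
      apply mul_pos hδ'0
      linarith
    have hsum : ∀ A' : Finset Ordinal.{u}, A'.card = A.card → A' ≠ A →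
        ∑ ξ ∈ A', s ξ ≤ ∑ ξ ∈ A, s ξ - γ := by
      intro A' hcard hne
      have e1 : ∑ ξ ∈ A', s ξ = ∑ ξ ∈ A' \ A, s ξ + ∑ ξ ∈ A' ∩ A, s ξ := by
        rw [add_comm]; exact (Finset.sum_inter_add_sum_sdiff A' A s).symm
      have e2 : ∑ ξ ∈ A, s ξ = ∑ ξ ∈ A \ A', s ξ + ∑ ξ ∈ A' ∩ A, s ξ := by
        rw [add_comm, Finset.inter_comm]; exact (Finset.sum_inter_add_sum_sdiff A A' s).symm
      have hc2 : (A' \ A).card = (A \ A').card := Finset.card_sdiff_comm hcard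
      have hpos : 1 ≤ (A' \ A).card := by
        rw [Nat.one_le_iff_ne_zero, Ne, Finset.card_eq_zero, Finset.sdiff_eq_empty_iff_subset]
        intro hsub
        exact hne (Finset.eq_of_subset_of_card_le hsub hcard.ge)
      have e3 : ∑ ξ ∈ A' \ A, s ξ ≤ (A' \ A).card * (b - δ') ^ 2 := by
        have := Finset.sum_le_card_nsmul (A' \ A) s ((b - δ') ^ 2)
          (fun ξ hξ => hout ξ (Finset.mem_sdiff.1 hξ).2)
        rwa [nsmul_eq_mul] at this
      have e4 : (A \ A').card * b ^ 2 ≤ ∑ ξ ∈ A \ A', s ξ := by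
        have := Finset.card_nsmul_le_sum (A \ A') s (b ^ 2)
          (fun ξ hξ => hin ξ (Finset.mem_sdiff.1 hξ).1)
        rwa [nsmul_eq_mul] at this
      rw [← hc2] at e4
      have e5 : (1:ℝ) ≤ (A' \ A).card := by exact_mod_cast hpos
      have e6 : 1 * γ ≤ (A' \ A).card * γ := by gcongr
      rw [hγ] at e6 ⊢
      linarith
    set k := A.card with hk
    set κ := γ / (4 * ((k:ℝ) + 1)) with hκ
    have hκ0 : 0 < κ := by positivity
    obtain ⟨l, hl⟩ := exists_nat_gt ((19 * ‖f‖ ^ 2) / κ)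
    have hl' : (1 / ((l:ℝ) + 1)) * (19 * ‖f‖ ^ 2) ≤ κ := by
      rw [div_lt_iff₀ hκ0] at hl
      rw [one_div, inv_mul_le_iff₀ (by positivity)]
      linarith
    have hQa := isQ_strat ρ H R O τa
    have hQb := isQ_strat ρ H R O τb
    refine ⟨Strat.node σ n k l τa τb, fun fr hfr => ?_⟩
    have hmain := gap_lemma
      (Q := fun A' : {A : Finset Ordinal.{u} // A.card = k} =>
        nodeQ ρ H R O σ n k l (stratQ ρ H R O τa) (stratQ ρ H R O τb) F A')
      (fun A' => isQ_node ρ H R O σ n k l hQa hQb F A' A'.2) hfr ⟨A, hk.symm⟩ hκ0 (by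
        rintro ⟨A', hA'⟩ hne
        have hne' : A' ≠ A := fun h => hne (Subtype.ext h)
        have hS := hsum A' hA' hne'
        have hk0 : 0 < k := by
          rcases Nat.eq_zero_or_pos k with h | h
          · exfalso
            apply hne'
            rw [h] at hA'
            rw [Finset.card_eq_zero.1 hA', Finset.card_eq_zero.1 (hk.symm.trans h)]
          · exact h
        have hk1 : (1:ℝ) ≤ k := by exact_mod_cast hk0
        have hS' : (1 / (k:ℝ)) * ∑ ξ ∈ A', s ξ ≤ (1 / (k:ℝ)) * ∑ ξ ∈ A, s ξ - 4 * κ := by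
          have e1 := mul_le_mul_of_nonneg_left hS (show (0:ℝ) ≤ 1 / (k:ℝ) by positivity)
          have e2 : 4 * κ ≤ (1 / (k:ℝ)) * γ := by
            rw [hκ, one_div, ← div_eq_inv_mul, ← mul_div_assoc, mul_div_mul_left _ _ four_ne_zero]
            gcongr
            linarith
          linarith
        have b1 := (hQa (F ∩ ⋃ ξ ∈ A', R n ξ)).bound f
        have b2 := (hQb (F \ ⋃ ξ ∈ A', O n ξ)).bound f
        have b3 := (hQa (F ∩ ⋃ ξ ∈ A, R n ξ)).nonneg f
        have b4 := (hQb (F \ ⋃ ξ ∈ A, O n ξ)).nonneg f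
        have c1 : ((1/2) * (1 / ((l:ℝ) + 1))) *
            ((1/2) * stratQ ρ H R O τa (F ∩ ⋃ ξ ∈ A', R n ξ) f
            + (1/2) * stratQ ρ H R O τb (F \ ⋃ ξ ∈ A', O n ξ) f) ≤
            ((1/2) * (1 / ((l:ℝ) + 1))) * (19 * ‖f‖ ^ 2) := by
          gcongr
          linarith
        have c2 : 0 ≤ ((1/2) * (1 / ((l:ℝ) + 1))) *
            ((1/2) * stratQ ρ H R O τa (F ∩ ⋃ ξ ∈ A, R n ξ) f
            + (1/2) * stratQ ρ H R O τb (F \ ⋃ ξ ∈ A, O n ξ) f) := by positivity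
        simp only [nodeQ]
        change (1/2) * ((1 / (k:ℝ)) * ∑ ξ ∈ A', s ξ) + _ ≤
          (1/2) * ((1 / (k:ℝ)) * ∑ ξ ∈ A, s ξ) + _ - κ
        linarith)
    have hmean := IsQ.mean (fun ξ => isQ_supQ (K := K) σ (F ∩ H n ∩ {x | ρ x = ξ})) A k hk.symm
    have hl0 : (0:ℝ) < (1/2) * (1 / ((l:ℝ) + 1)) := by positivity
    have hpair := (hQa (F ∩ ⋃ ξ ∈ A, R n ξ)).comb (hQb (F \ ⋃ ξ ∈ A, O n ξ))
      (a := 1/2) (b := 1/2) (by norm_num) (by norm_num) (by norm_num)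
    have d1 := defect_comb_tendsto hmean hpair (by norm_num) hl0 hmain
    have d2 := defect_comb_tendsto (hQa (F ∩ ⋃ ξ ∈ A, R n ξ)) (hQb (F \ ⋃ ξ ∈ A, O n ξ))
      (by norm_num) (by norm_num) d1
    have d3 := defect_comb_tendsto (hQb (F \ ⋃ ξ ∈ A, O n ξ)) (hQa (F ∩ ⋃ ξ ∈ A, R n ξ))
      (a := 1/2) (b := 1/2) (by norm_num) (by norm_num) (f := f) (fr := fr)
      (by simpa only [add_comm] using d1)
    filter_upwards [hτa fr d3, hτb fr d2] with r ra rb x hx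
    by_cases hxO : x ∈ ⋃ ξ ∈ A, O n ξ
    · exact ra x ⟨hx, Set.iUnion₂_mono (fun ξ _ => hD.OR n ξ) hxO⟩
    · exact rb x ⟨hx, hxO⟩

end Functionals

/-! ### Construction of the datum -/

section Datum

variable {K : Type u} [TopologicalSpace K]

lemma exists_nbhd_of_generateOpen {B : ℕ → Set K} {S : Set K}
    (hS : TopologicalSpace.GenerateOpen ({U | IsOpen U} ∪ Set.range B) S) :
    ∀ x ∈ S, ∃ U : Set K, IsOpen U ∧ x ∈ U ∧ ∃ p : Finset ℕ, (∀ i ∈ p, x ∈ B i) ∧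
      ∀ y ∈ U, (∀ i ∈ p, y ∈ B i) → y ∈ S := by
  induction hS with
  | basic s hs =>
    intro x hx
    rcases hs with hs | ⟨n, rfl⟩
    · exact ⟨s, hs, hx, ∅, by simp, fun y hy _ => hy⟩
    · exact ⟨Set.univ, isOpen_univ, trivial, {n}, by simpa using hx, fun y _ h => by simpa using h⟩
  | univ => exact fun x _ => ⟨Set.univ, isOpen_univ, trivial, ∅, by simp, fun _ _ _ => trivial⟩
  | inter s t _ _ ihs iht =>
    rintro x ⟨hs, ht⟩
    obtain ⟨U, hU, hxU, p, hp, h⟩ := ihs x hs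
    obtain ⟨V, hV, hxV, q, hq, h'⟩ := iht x ht
    refine ⟨U ∩ V, hU.inter hV, ⟨hxU, hxV⟩, p ∪ q, ?_, ?_⟩
    · intro i hi
      rcases Finset.mem_union.1 hi with hi | hi
      · exact hp i hi
      · exact hq i hi
    · intro y hy hyi
      exact ⟨h y hy.1 fun i hi => hyi i (Finset.mem_union_left _ hi),
        h' y hy.2 fun i hi => hyi i (Finset.mem_union_right _ hi)⟩
  | sUnion S _ ih =>
    rintro x ⟨s, hs, hx⟩
    obtain ⟨U, hU, hxU, p, hp, h⟩ := ih s hs x hx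
    exact ⟨U, hU, hxU, p, hp, fun y hy hyp => ⟨s, hs, h y hy hyp⟩⟩

lemma exists_network {d : K → K → ℝ} (hmet : IsMetricOn K d)
    (hP : PropertyP ‹TopologicalSpace K› d) :
    ∃ B : Finset ℕ → Set K, ∀ x, ∀ ε > 0, ∃ p, x ∈ B p ∧ ∃ U : Set K, IsOpen U ∧ x ∈ U ∧
      ∀ y ∈ U ∩ B p, d x y < ε := by
  obtain ⟨B, hB⟩ := hP
  refine ⟨fun p => {y | ∀ i ∈ p, y ∈ B i}, fun x ε hε => ?_⟩
  have h1 : IsOpen[metricTopology d] {y | d x y < ε} :=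
    TopologicalSpace.GenerateOpen.basic _ ⟨x, ε, hε, rfl⟩
  have h2 := hB _ h1
  obtain ⟨U, hU, hxU, p, hp, h⟩ := exists_nbhd_of_generateOpen h2 x
    (by simpa [hmet.self_eq_zero] using hε)
  exact ⟨p, hp, U, hU, hxU, fun y hy => h y hy.1 hy.2⟩

lemma IsMetricOn.nonneg {d : K → K → ℝ} (hmet : IsMetricOn K d) (x y : K) : 0 ≤ d x y := by
  have h := hmet.triangle x y x
  rw [hmet.self_eq_zero, hmet.symm y x] at h
  linarith

lemma isClosed_dball {d : K → K → ℝ} (hlsc : LowerSemicontinuous fun p : K × K => d p.1 p.2)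
    (x : K) (r : ℝ) : IsClosed {y | d x y ≤ r} := by
  have := hlsc.isClosed_preimage r
  exact this.preimage (f := fun y : K => (x, y)) (by fun_prop)

lemma exists_delta [CompactSpace K] {d : K → K → ℝ} (hmet : IsMetricOn K d)
    (hlsc : LowerSemicontinuous fun p : K × K => d p.1 p.2) (f : C(K, ℝ)) {η : ℝ} (hη : 0 < η) :
    ∃ δ > 0, ∀ x y, d x y < δ → |f x - f y| < η := by
  set S : Set (K × K) := {p | η ≤ |f p.1 - f p.2|} with hS
  have hSc : IsClosed S := isClosed_le continuous_const (by fun_prop)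
  rcases S.eq_empty_or_nonempty with he | hne
  · refine ⟨1, one_pos, fun x y _ => ?_⟩
    by_contra h
    have : (x, y) ∈ S := not_lt.1 h
    rw [he] at this
    exact this
  · obtain ⟨z, hz, hmin⟩ := LowerSemicontinuousOn.exists_isMinOn hne hSc.isCompact
      (hlsc.lowerSemicontinuousOn S)
    refine ⟨d z.1 z.2, lt_of_le_of_ne (hmet.nonneg _ _) fun h => ?_, fun x y hxy => ?_⟩
    · have := hmet.eq_of_dist_eq_zero _ _ h.symm
      have hz' : η ≤ |f z.1 - f z.2| := hz
      rw [this, sub_self, abs_zero] at hz'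
      linarith
    · by_contra h
      have : (x, y) ∈ S := not_lt.1 h
      have := hmin this
      simp only [Set.mem_ofPred_eq] at this
      linarith

lemma exists_fragment [CompactSpace K] [T2Space K] {d : K → K → ℝ} (hmet : IsMetricOn K d)
    (hlsc : LowerSemicontinuous fun p : K × K => d p.1 p.2) {B : Finset ℕ → Set K}
    (hB : ∀ x, ∀ ε > 0, ∃ p, x ∈ B p ∧ ∃ U : Set K, IsOpen U ∧ x ∈ U ∧ ∀ y ∈ U ∩ B p, d x y < ε)
    {ε : ℝ} (hε : 0 < ε) {F : Set K} (hF : IsClosed F) (hne : F.Nonempty) :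
    ∃ W : Set K, IsOpen W ∧ (W ∩ F).Nonempty ∧ ∀ x ∈ W ∩ F, ∀ y ∈ W ∩ F, d x y ≤ ε := by
  set G : Finset ℕ → Set F := fun p => {x | (x : K) ∈ B p ∧ ∃ U : Set K, IsOpen U ∧ (x : K) ∈ U ∧
    ∀ y ∈ U ∩ B p, d x y < ε / 2} with hG
  have : CompactSpace F := isCompact_iff_compactSpace.1 hF.isCompact
  have : Nonempty F := hne.to_subtype
  obtain ⟨p, hp⟩ := nonempty_interior_of_iUnion_of_closed (f := fun p => closure (G p))
    (fun p => isClosed_closure) (by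
      rw [Set.eq_univ_iff_forall]
      intro x
      obtain ⟨p, hp⟩ := hB x (ε / 2) (by positivity)
      exact Set.mem_iUnion.2 ⟨p, subset_closure hp⟩)
  obtain ⟨W₀, hW₀, hW₀'⟩ := isOpen_induced_iff.1 (isOpen_interior (s := closure (G p)))
  obtain ⟨x₀, hx₀⟩ := hp
  obtain ⟨x, hxi, hxG⟩ := mem_closure_iff.1 (interior_subset hx₀) _ isOpen_interior hx₀
  obtain ⟨hxB, U, hU, hxU, hball⟩ := hxG
  have key : ∀ y ∈ (W₀ ∩ U) ∩ F, d x y ≤ ε / 2 := by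
    rintro y ⟨⟨hyW, hyU⟩, hyF⟩
    have hy : (⟨y, hyF⟩ : F) ∈ closure (G p) := by
      apply interior_subset
      rw [← hW₀']
      exact hyW
    have h2 : y ∈ closure (U ∩ B p) := by
      rw [mem_closure_iff]
      intro V hV hyV
      obtain ⟨z, hzV, hzG⟩ := mem_closure_iff.1 hy ((↑) ⁻¹' (V ∩ U))
        ((hV.inter hU).preimage continuous_subtype_val) ⟨hyV, hyU⟩
      exact ⟨z, hzV.1, hzV.2, hzG.1⟩
    exact closure_minimal (t := {y | d x y ≤ ε / 2}) (fun z hz => (hball z hz).le)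
      (isClosed_dball hlsc _ _) h2
  refine ⟨W₀ ∩ U, hW₀.inter hU, ⟨x, ⟨?_, hxU⟩, x.2⟩, fun y hy z hz => ?_⟩
  · rw [← hW₀'] at hxi
    exact hxi
  · have h1 := key y hy
    have h2 := key z hz
    have h3 := hmet.triangle y x z
    rw [hmet.symm y x] at h3
    linarith

/-- Transfinite selection. -/
noncomputable def rk (sel : Set K → C(K, ℝ)) (ξ : Ordinal.{u}) : C(K, ℝ) :=
  sel {x | ∀ η, η < ξ → ¬ 0 < rk sel η x}
termination_by ξ

lemma exists_rank [CompactSpace K] [T2Space K] {d : K → K → ℝ} (hmet : IsMetricOn K d)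
    (hlsc : LowerSemicontinuous fun p : K × K => d p.1 p.2) {B : Finset ℕ → Set K}
    (hB : ∀ x, ∀ ε > 0, ∃ p, x ∈ B p ∧ ∃ U : Set K, IsOpen U ∧ x ∈ U ∧ ∀ y ∈ U ∩ B p, d x y < ε)
    {ε : ℝ} (hε : 0 < ε) :
    ∃ (v : Ordinal.{u} → C(K, ℝ)) (ρ : K → Ordinal.{u}), (∀ x, 0 < v (ρ x) x) ∧
      (∀ ξ y, 0 < v ξ y → ρ y ≤ ξ) ∧ ∀ x y, ρ x = ρ y → d x y ≤ ε := by
  have hsel : ∀ F : Set K, ∃ w : C(K, ℝ), IsClosed F → F.Nonempty →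
      (∃ x ∈ F, 0 < w x) ∧ ∀ x ∈ F, ∀ y ∈ F, 0 < w x → 0 < w y → d x y ≤ ε := by
    intro F
    by_cases h : IsClosed F ∧ F.Nonempty
    · obtain ⟨W, hW, ⟨x, hxW, hxF⟩, hd⟩ := exists_fragment hmet hlsc hB hε h.1 h.2
      obtain ⟨w, hw0, hw1, -⟩ := exists_continuous_zero_one_of_isClosed
        hW.isClosed_compl (isClosed_singleton (x := x))
        (by simpa [Set.disjoint_singleton_right] using hxW)
      have hpos : ∀ y, 0 < w y → y ∈ W := by
        intro y hy
        by_contra hyW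
        have := hw0 hyW
        simp only [Pi.zero_apply] at this
        linarith
      refine ⟨w, fun _ _ => ⟨⟨x, hxF, ?_⟩, fun y hy z hz hy' hz' => ?_⟩⟩
      · have := hw1 (Set.mem_singleton x)
        rw [this]; exact one_pos
      · exact hd y ⟨hpos y hy', hy⟩ z ⟨hpos z hz', hz⟩
    · exact ⟨0, fun h1 h2 => absurd ⟨h1, h2⟩ h⟩
  choose sel hsel using hsel
  have hrk : ∀ ξ, rk sel ξ = sel {x | ∀ η, η < ξ → ¬ 0 < rk sel η x} := fun ξ => by rw [rk]
  have hcl : ∀ ξ : Ordinal.{u}, IsClosed {x | ∀ η, η < ξ → ¬ 0 < rk sel η x} := by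
    intro ξ
    simp only [Set.ofPred_forall, not_lt]
    exact isClosed_iInter fun η => isClosed_iInter fun _ =>
      isClosed_le (by fun_prop) continuous_const
  have hex : ∀ x, ∃ ξ, 0 < rk sel ξ x := by
    by_contra hcon
    push Not at hcon
    obtain ⟨x, hx⟩ := hcon
    have hne : ∀ ξ : Ordinal.{u}, ({x | ∀ η, η < ξ → ¬ 0 < rk sel η x} : Set K).Nonempty :=
      fun ξ => ⟨x, fun η _ => not_lt.2 (hx η)⟩
    have hpt : ∀ ξ : Ordinal.{u}, ∃ y, (∀ η, η < ξ → ¬ 0 < rk sel η y) ∧ 0 < rk sel ξ y := by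
      intro ξ
      obtain ⟨y, hy, hy'⟩ := (hsel _ (hcl ξ) (hne ξ)).1
      exact ⟨y, hy, by rw [hrk]; exact hy'⟩
    choose g hg hg' using hpt
    apply not_injective_of_ordinal g
    intro a b hab
    rcases lt_trichotomy a b with h | h | h
    · exact absurd (hab ▸ hg' a) (hg b a h)
    · exact h
    · exact absurd (hab ▸ hg' b) (hg a b h)
  have hmin : ∀ x, ∃ ξ, 0 < rk sel ξ x ∧ ∀ η, 0 < rk sel η x → ξ ≤ η := by
    intro x
    exact ⟨sInf {ξ | 0 < rk sel ξ x}, csInf_mem (hex x), fun η hη => csInf_le' hη⟩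
  choose ρ hρ hρ' using hmin
  have hmemF : ∀ x, x ∈ {x | ∀ η, η < ρ x → ¬ 0 < rk sel η x} := fun x η hη h =>
    not_lt.2 (hρ' x η h) hη
  refine ⟨rk sel, ρ, hρ, fun ξ y h => hρ' y ξ h, fun x y hxy => ?_⟩
  have hx : x ∈ {z | ∀ η, η < ρ x → ¬ 0 < rk sel η z} := hmemF x
  have hy : y ∈ {z | ∀ η, η < ρ x → ¬ 0 < rk sel η z} := by rw [hxy]; exact hmemF y
  have hx' := hρ x
  have hy' := hρ y
  rw [← hxy] at hy'
  rw [hrk] at hx' hy'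
  exact (hsel _ (hcl (ρ x)) ⟨x, hx⟩).2 x hx y hy hx' hy'

lemma exists_pick [CompactSpace K] {H J : ℕ → Set K} (hJ : ∀ i, IsClosed (J i))
    (hcov : ∀ x, ∃ i, x ∈ H i ∧ x ∉ J i) {P : Set K} (hP : IsClosed P) (hne : P.Nonempty) :
    ∃ (s : Finset ℕ) (n : ℕ), (P ∩ ⋂ i ∈ s, J i) ∩ H n ≠ ∅ ∧ (P ∩ ⋂ i ∈ s, J i) ∩ J n = ∅ := by
  classical
  by_contra hcon
  push Not at hcon
  set nx : ℕ → Finset ℕ → Finset ℕ := fun n s =>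
    if ((P ∩ ⋂ i ∈ s, J i) ∩ J n).Nonempty then insert n s else s with hnx
  set S : ℕ → Finset ℕ := fun n => Nat.rec ∅ nx n with hS
  have hpos : ∀ n, ((P ∩ ⋂ i ∈ S n, J i) ∩ J n).Nonempty → S (n + 1) = insert n (S n) :=
    fun n h => if_pos h
  have hneg : ∀ n, ¬ ((P ∩ ⋂ i ∈ S n, J i) ∩ J n).Nonempty → S (n + 1) = S n :=
    fun n h => if_neg h
  have hins : ∀ n (s : Finset ℕ), (P ∩ ⋂ i ∈ insert n s, J i) = (P ∩ ⋂ i ∈ s, J i) ∩ J n := by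
    intro n s
    rw [Finset.set_biInter_insert, Set.inter_assoc, Set.inter_comm (J n)]
  have hSne : ∀ n, (P ∩ ⋂ i ∈ S n, J i).Nonempty := by
    intro n
    induction n with
    | zero => simpa [hS] using hne
    | succ n ih =>
      by_cases h : ((P ∩ ⋂ i ∈ S n, J i) ∩ J n).Nonempty
      · rw [hpos n h, hins]; exact h
      · rw [hneg n h]; exact ih
  have hcl : ∀ s : Finset ℕ, IsClosed (P ∩ ⋂ i ∈ s, J i) := fun s =>
    hP.inter (isClosed_biInter fun i _ => hJ i)
  obtain ⟨x, hx⟩ := IsCompact.nonempty_iInter_of_sequence_nonempty_isCompact_isClosed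
    (fun n => P ∩ ⋂ i ∈ S n, J i) (by
      intro n
      by_cases h : ((P ∩ ⋂ i ∈ S n, J i) ∩ J n).Nonempty
      · rw [hpos n h, hins]; exact Set.inter_subset_left
      · rw [hneg n h]) hSne (hcl _).isCompact (fun n => hcl _)
  rw [Set.mem_iInter] at hx
  obtain ⟨n, hn, hn'⟩ := hcov x
  have h1 : ((P ∩ ⋂ i ∈ S n, J i) ∩ J n).Nonempty :=
    hcon (S n) n ⟨x, hx n, hn⟩
  have h2 := hx (n + 1)
  rw [hpos n h1, hins] at h2
  exact hn' h2.2

lemma exists_datum [CompactSpace K] [T2Space K] {d : K → K → ℝ} (hmet : IsMetricOn K d)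
    (hlsc : LowerSemicontinuous fun p : K × K => d p.1 p.2)
    (hP : PropertyP ‹TopologicalSpace K› d) {ε : ℝ} (hε : 0 < ε) :
    ∃ (ρ : K → Ordinal.{u}) (H : ℕ → Set K) (R O : ℕ → Ordinal.{u} → Set K),
      IsDatum ρ H R O ∧ ∀ x y, ρ x = ρ y → d x y ≤ ε := by
  obtain ⟨B, hB⟩ := exists_network hmet hP
  obtain ⟨v, ρ, hv1, hv2, hρd⟩ := exists_rank hmet hlsc hB hε
  obtain ⟨e, he⟩ := exists_surjective_nat (ℕ × ℕ × Finset ℕ)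
  obtain ⟨e', he'⟩ := exists_surjective_nat (Finset ℕ × ℕ)
  have hrc : ∀ ξ, IsClosed {x | ξ ≤ ρ x} := by
    intro ξ
    have : {x | ξ ≤ ρ x} = ⋂ η, ⋂ (_ : η < ξ), {x | v η x ≤ 0} := by
      ext x
      simp only [Set.mem_iInter, Set.mem_ofPred_eq]
      constructor
      · intro h η hη
        by_contra hc
        exact absurd (h.trans (hv2 η x (not_le.1 hc))) (not_le.2 hη)
      · intro h
        by_contra hc
        exact absurd (hv1 x) (not_lt.2 (h _ (not_le.1 hc)))
    rw [this]
    exact isClosed_iInter fun η => isClosed_iInter fun _ =>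
      isClosed_le (by fun_prop) continuous_const
  -- the pieces
  set C : ℕ → Set K := fun n => {x | 1 / (((e n).1 : ℝ) + 1) ≤ v (ρ x) x ∧
    (∀ y, d x y < 1 / (((e n).2.1 : ℝ) + 1) → ρ x ≤ ρ y → 0 < v (ρ x) y) ∧
    x ∈ B (e n).2.2 ∧ ∃ U : Set K, IsOpen U ∧ x ∈ U ∧
      ∀ y ∈ U ∩ B (e n).2.2, d x y < 1 / (((e n).2.1 : ℝ) + 1)} with hC
  set J : ℕ → Set K := fun n => closure (C n) \
    ⋃₀ {U | IsOpen U ∧ ∀ y ∈ U ∩ closure (C n), ∀ z ∈ U ∩ closure (C n), ρ y = ρ z} with hJ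
  have hJc : ∀ n, IsClosed (J n) := fun n =>
    isClosed_closure.sdiff (isOpen_sUnion fun U hU => hU.1)
  have hcl : ∀ n (U : Set K), IsOpen U → ∀ z ∈ U ∩ closure (C n), z ∈ closure (U ∩ C n) := by
    intro n U hU z hz
    exact hU.inter_closure hz
  have hCJ : ∀ n, ∀ x ∈ C n, x ∉ J n := by
    intro n x hx hxJ
    obtain ⟨h1, h2, h3, U, hU, hxU, h4⟩ := hx
    have hconst : ∀ y ∈ U ∩ C n, ρ y = ρ x := by
      rintro y ⟨hyU, hyC⟩
      have hxy := h4 y ⟨hyU, hyC.2.2.1⟩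
      rcases le_total (ρ x) (ρ y) with h | h
      · exact le_antisymm (hv2 _ _ (h2 y hxy h)) h
      · exact le_antisymm h (hv2 _ _ (hyC.2.1 x (by rw [hmet.symm]; exact hxy) h))
    have hconst' : ∀ z ∈ U ∩ closure (C n), ρ z = ρ x := by
      intro z hz
      have hz' := hcl n U hU z hz
      have hsub : U ∩ C n ⊆ {y | ρ x ≤ ρ y} ∩ {y | 1 / (((e n).1 : ℝ) + 1) ≤ v (ρ x) y} := by
        intro y hy
        refine ⟨(hconst y hy).ge, ?_⟩
        have := hy.2.1
        rw [hconst y hy] at this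
        exact this
      have := closure_minimal hsub ((hrc _).inter
        (isClosed_le continuous_const (by fun_prop))) hz'
      refine le_antisymm (hv2 _ _ (lt_of_lt_of_le ?_ this.2)) this.1
      positivity
    exact hxJ.2 ⟨U, ⟨hU, fun y hy z hz => (hconst' y hy).trans (hconst' z hz).symm⟩, hxU⟩
  have hcov : ∀ x, ∃ n, x ∈ closure (C n) ∧ x ∉ J n := by
    intro x
    obtain ⟨m, hm⟩ := exists_nat_one_div_lt (hv1 x)
    obtain ⟨δ, hδ, hδ'⟩ := exists_delta hmet hlsc (v (ρ x)) (hv1 x)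
    obtain ⟨j, hj⟩ := exists_nat_one_div_lt hδ
    obtain ⟨p, hp, hU⟩ := hB x (1 / ((j : ℝ) + 1)) (by positivity)
    obtain ⟨n, hn⟩ := he (m, j, p)
    have hx : x ∈ C n := by
      refine ⟨?_, ?_, ?_, ?_⟩
      · rw [hn]; exact hm.le
      · rw [hn]
        intro y hy _
        have := (abs_lt.1 (hδ' x y (hy.trans hj))).2
        linarith
      · rw [hn]; exact hp
      · rw [hn]; exact hU
    exact ⟨n, subset_closure hx, hCJ n x hx⟩
  have hlarge : ∀ n, ∀ x ∈ closure (C n), x ∉ J n → 1 / (((e n).1 : ℝ) + 1) ≤ v (ρ x) x ∧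
      ∃ U, IsOpen U ∧ x ∈ U ∧ ∀ y ∈ U ∩ closure (C n), ρ y = ρ x := by
    intro n x hx hxJ
    have : x ∈ ⋃₀ {U | IsOpen U ∧ ∀ y ∈ U ∩ closure (C n), ∀ z ∈ U ∩ closure (C n), ρ y = ρ z} := by
      by_contra h
      exact hxJ ⟨hx, h⟩
    obtain ⟨U, ⟨hU, hUc⟩, hxU⟩ := this
    refine ⟨?_, U, hU, hxU, fun y hy => hUc y hy x ⟨hxU, hx⟩⟩
    refine closure_minimal (s := U ∩ C n) (t := {y | 1 / (((e n).1 : ℝ) + 1) ≤ v (ρ x) y})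
      ?_ (isClosed_le continuous_const (by fun_prop)) (hcl n U hU x ⟨hxU, hx⟩)
    intro y hy
    have h1 := hy.2.1
    rw [hUc y ⟨hy.1, subset_closure hy.2⟩ x ⟨hxU, hx⟩] at h1
    exact h1
  refine ⟨ρ, fun n => closure (C (e' n).2) ∩ ⋂ i ∈ (e' n).1, J i,
    fun n ξ => {x | 1 / (((e (e' n).2).1 : ℝ) + 2) ≤ v ξ x},
    fun n ξ => {x | 1 / (((e (e' n).2).1 : ℝ) + 2) < v ξ x}, ⟨?_, ?_, ?_, ?_, ?_, ?_⟩, hρd⟩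
  · exact fun n => isClosed_closure.inter (isClosed_biInter fun i _ => hJc i)
  · exact fun n ξ => isClosed_le continuous_const (by fun_prop)
  · exact fun n ξ => isOpen_lt continuous_const (by fun_prop)
  · intro n ξ x hx
    have hx' : 1 / (((e (e' n).2).1 : ℝ) + 2) < v ξ x := hx
    exact hx'.le
  · intro n ξ x hx
    refine hv2 ξ x (lt_of_lt_of_le ?_ hx)
    positivity
  · intro P hPc hPne
    obtain ⟨s, n, h1, h2⟩ := exists_pick (H := fun n => closure (C n)) hJc hcov hPc hPne
    obtain ⟨k, hk⟩ := he' (s, n)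
    refine ⟨k, ?_, ?_⟩
    · rw [hk]
      obtain ⟨x, ⟨hxP, hxs⟩, hxn⟩ := Set.nonempty_iff_ne_empty.2 h1
      exact ⟨x, hxP, hxn, hxs⟩
    · rw [hk]
      rintro x ⟨hxP, hxn, hxs⟩
      have hxJ : x ∉ J n := by
        intro hxJ
        have : x ∈ (P ∩ ⋂ i ∈ s, J i) ∩ J n := ⟨⟨hxP, hxs⟩, hxJ⟩
        rw [h2] at this
        exact this
      obtain ⟨h3, U, hU, hxU, hUc⟩ := hlarge n x hxn hxJ
      refine ⟨lt_of_lt_of_le ?_ h3, U, hU, hxU, fun y hy => hUc y ⟨hy.1, hy.2.1⟩⟩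
      apply one_div_lt_one_div_of_lt
      · positivity
      · simp

end Datum

/-! ### The norm -/

section FinalNorm

variable {X : Type*} [NormedAddCommGroup X] [NormedSpace ℝ X] {ι : Type*} [Encodable ι]

lemma exists_norm_of_family (Q : ι → X → ℝ) (hQ : ∀ i, IsQ (Q i))
    (hN : IsQ (fun f : X => ‖f‖ ^ 2)) :
    ∃ N : X → ℝ, IsNorm N ∧
      (∃ c C : ℝ, 0 < c ∧ c ≤ C ∧ ∀ f : X, c * ‖f‖ ≤ N f ∧ N f ≤ C * ‖f‖) ∧
      ∀ (f : X) (fr : ℕ → X), Tendsto (fun r => (1/2) * N f ^ 2 + (1/2) * N (fr r) ^ 2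
        - N ((1/2 : ℝ) • (f + fr r)) ^ 2) atTop (𝓝 0) →
        Tendsto (fun r => defect (fun f : X => ‖f‖ ^ 2) f (fr r)) atTop (𝓝 0) ∧
        ∀ i, Tendsto (fun r => defect (Q i) f (fr r)) atTop (𝓝 0) := by
  set w : ι → ℝ := fun i => (1/2 : ℝ) ^ Encodable.encode i with hw
  have hw0 : ∀ i, 0 < w i := fun i => by positivity
  have hws : Summable w := summable_geometric_two_encode
  set G : ι → X → ℝ := fun i f => Q i f + Q i (-f) with hG
  have hG0 : ∀ i f, 0 ≤ G i f := fun i f => add_nonneg ((hQ i).nonneg f) ((hQ i).nonneg (-f))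
  have hGb : ∀ i f, G i f ≤ 38 * ‖f‖ ^ 2 := by
    intro i f
    have h1 := (hQ i).bound f
    have h2 := (hQ i).bound (-f)
    rw [norm_neg] at h2
    simp only [hG]
    linarith
  have hGs : ∀ i (c : ℝ) f, G i (c • f) = c ^ 2 * G i f := by
    intro i c f
    rcases le_total 0 c with hc | hc
    · simp only [hG]
      rw [← smul_neg, (hQ i).smul c hc, (hQ i).smul c hc]
      ring
    · have e1 : c • f = (-c) • (-f) := by simp
      have e2 : -(c • f) = (-c) • f := by simp
      simp only [hG]
      rw [e2, e1, (hQ i).smul (-c) (by linarith), (hQ i).smul (-c) (by linarith)]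
      ring
  have hGa : ∀ i (s : ℝ), 0 < s → ∀ f g, G i (f + g) ≤ (1 + s) * G i f + (1 + s⁻¹) * G i g := by
    intro i s hs f g
    have h1 := (hQ i).add s hs f g
    have h2 := (hQ i).add s hs (-f) (-g)
    simp only [hG]
    rw [neg_add]
    linarith
  have hsum : ∀ f, Summable fun i => w i * G i f := by
    intro f
    refine Summable.of_nonneg_of_le (fun i => mul_nonneg (hw0 i).le (hG0 i f)) (fun i => ?_)
      (hws.mul_right (38 * ‖f‖ ^ 2))
    have := hw0 i
    have := hGb i f
    gcongr
  set M : X → ℝ := fun f => ‖f‖ ^ 2 + ∑' i, w i * G i f with hM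
  have hT0 : ∀ f, 0 ≤ ∑' i, w i * G i f := fun f =>
    tsum_nonneg fun i => mul_nonneg (hw0 i).le (hG0 i f)
  have hM0 : ∀ f, 0 ≤ M f := fun f => add_nonneg (by positivity) (hT0 f)
  have hMge : ∀ f, ‖f‖ ^ 2 ≤ M f := fun f => le_add_of_nonneg_right (hT0 f)
  have hMs : ∀ (c : ℝ) f, M (c • f) = c ^ 2 * M f := by
    intro c f
    simp only [hM, hGs, norm_smul, Real.norm_eq_abs, mul_pow, sq_abs]
    rw [mul_add, ← tsum_mul_left]
    congr 2
    funext i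
    ring
  have hMa : ∀ f g (s : ℝ), 0 < s → M (f + g) ≤ (1 + s) * M f + (1 + s⁻¹) * M g := by
    intro f g s hs
    have h1 := hN.add s hs f g
    have h2 : ∑' i, w i * G i (f + g) ≤
        (1 + s) * ∑' i, w i * G i f + (1 + s⁻¹) * ∑' i, w i * G i g := by
      rw [← tsum_mul_left, ← tsum_mul_left,
        ← Summable.tsum_add ((hsum f).mul_left _) ((hsum g).mul_left _)]
      refine Summable.tsum_le_tsum (fun i => ?_) (hsum _)
        (((hsum f).mul_left _).add ((hsum g).mul_left _))
      have := mul_le_mul_of_nonneg_left (hGa i s hs f g) (hw0 i).le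
      linarith
    simp only [hM] at *
    linarith
  set Wt := ∑' i, w i with hWt
  have hWt0 : 0 ≤ Wt := tsum_nonneg fun i => (hw0 i).le
  have hMle : ∀ f, M f ≤ (1 + 38 * Wt) * ‖f‖ ^ 2 := by
    intro f
    have : ∑' i, w i * G i f ≤ Wt * (38 * ‖f‖ ^ 2) := by
      rw [hWt, ← tsum_mul_right]
      refine Summable.tsum_le_tsum (fun i => ?_) (hsum _) (hws.mul_right _)
      have := hw0 i
      have := hGb i f
      gcongr
    simp only [hM]
    linarith
  have hge : ∀ f, ‖f‖ ≤ √(M f) := fun f => Real.le_sqrt_of_sq_le (hMge f)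
  refine ⟨fun f => √(M f), ⟨fun f => Real.sqrt_nonneg _, ?_, ?_, ?_⟩, ?_, ?_⟩
  · intro f hf
    have h1 := hge f
    simp only at hf
    rw [hf] at h1
    exact norm_le_zero_iff.1 h1
  · intro c f
    simp only
    rw [hMs, Real.sqrt_mul (sq_nonneg c), Real.sqrt_sq_eq_abs]
  · intro f g
    exact sqrt_add_of hM0 (fun s hs f g => hMa f g s hs) f g
  · refine ⟨1, √(1 + 38 * Wt), one_pos, ?_, fun f => ⟨by rw [one_mul]; exact hge f, ?_⟩⟩
    · apply Real.le_sqrt_of_sq_le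
      linarith
    · calc √(M f) ≤ √((1 + 38 * Wt) * ‖f‖ ^ 2) := Real.sqrt_le_sqrt (hMle f)
        _ = √(1 + 38 * Wt) * ‖f‖ := by
          rw [Real.sqrt_mul (by positivity), Real.sqrt_sq (norm_nonneg f)]
  · intro f fr h
    simp only [Real.sq_sqrt (hM0 _)] at h
    have hdec : ∀ g, (1/2) * M f + (1/2) * M g - M ((1/2 : ℝ) • (f + g)) =
        defect (fun f : X => ‖f‖ ^ 2) f g +
        ∑' i, w i * (defect (Q i) f g + defect (Q i) (-f) (-g)) := by
      intro g
      have e : (fun i => w i * (defect (Q i) f g + defect (Q i) (-f) (-g))) = fun i =>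
          (1/2) * (w i * G i f) + (1/2) * (w i * G i g) - w i * G i ((1/2 : ℝ) • (f + g)) := by
        funext i
        simp only [defect, hG]
        rw [show -((1/2 : ℝ) • (f + g)) = (1/2 : ℝ) • (-f + -g) by rw [← smul_neg, neg_add]]
        ring
      rw [e, Summable.tsum_sub (((hsum f).mul_left _).add ((hsum g).mul_left _)) (hsum _),
        Summable.tsum_add ((hsum f).mul_left _) ((hsum g).mul_left _), tsum_mul_left,
        tsum_mul_left]
      simp only [hM, defect]
      ring
    have hsd : ∀ g, Summable fun i => w i * (defect (Q i) f g + defect (Q i) (-f) (-g)) := by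
      intro g
      have e : (fun i => w i * (defect (Q i) f g + defect (Q i) (-f) (-g))) = fun i =>
          (1/2) * (w i * G i f) + (1/2) * (w i * G i g) - w i * G i ((1/2 : ℝ) • (f + g)) := by
        funext i
        simp only [defect, hG]
        rw [show -((1/2 : ℝ) • (f + g)) = (1/2 : ℝ) • (-f + -g) by rw [← smul_neg, neg_add]]
        ring
      rw [e]
      exact (((hsum f).mul_left _).add ((hsum g).mul_left _)).sub (hsum _)
    have hdn : ∀ g i, 0 ≤ w i * (defect (Q i) f g + defect (Q i) (-f) (-g)) := fun g i =>
      mul_nonneg (hw0 i).le (add_nonneg ((hQ i).defect_nonneg _ _) ((hQ i).defect_nonneg _ _))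
    simp only [hdec] at h
    refine ⟨?_, fun i => ?_⟩
    · refine squeeze_zero (fun r => hN.defect_nonneg _ _) (fun r => ?_) h
      exact le_add_of_nonneg_right (tsum_nonneg (hdn (fr r)))
    · have h2 : Tendsto (fun r => w i * defect (Q i) f (fr r)) atTop (𝓝 0) := by
        refine squeeze_zero (fun r => mul_nonneg (hw0 i).le ((hQ i).defect_nonneg _ _))
          (fun r => ?_) h
        have h3 := (hsd (fr r)).le_tsum i (fun j _ => hdn (fr r) j)
        have h4 := hN.defect_nonneg f (fr r)
        have h5 := mul_nonneg (hw0 i).le ((hQ i).defect_nonneg (-f) (-(fr r)))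
        linarith
      have h3 := h2.const_mul (w i)⁻¹
      rw [mul_zero] at h3
      refine h3.congr fun r => ?_
      rw [inv_mul_cancel_left₀ (hw0 i).ne']

end FinalNorm

/-- Theorem B: if `K` is a Namioka–Phelps compact (a compact Hausdorff space having
property `P(d,T)` for some lower semicontinuous metric `d` whose topology is finer
than `T`), then `C(K)` admits a norm, equivalent to the supremum norm, which is
locally uniformly convex. -/
theorem theoremB {K : Type*} [TopologicalSpace K] [CompactSpace K] [T2Space K]
    (d : K → K → ℝ) (hmet : IsMetricOn K d)
    (hfiner : metricTopology d ≤ ‹TopologicalSpace K›)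
    (hlsc : LowerSemicontinuous fun p : K × K => d p.1 p.2)
    (hP : PropertyP ‹TopologicalSpace K› d) :
    ∃ N : C(K, ℝ) → ℝ, IsNorm N ∧
      (∃ c C : ℝ, 0 < c ∧ c ≤ C ∧ ∀ f : C(K, ℝ), c * ‖f‖ ≤ N f ∧ N f ≤ C * ‖f‖) ∧
      ∀ f : C(K, ℝ), LURAt N f := by
  choose ρ H R O hD hd using fun q : ℕ =>
    exists_datum hmet hlsc hP (ε := 1 / ((q : ℝ) + 1)) (by positivity)
  obtain ⟨N, hN, ⟨c, C, hc, hcC, hcN⟩, hdef⟩ := exists_norm_of_family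
    (fun (j : ℕ × Strat) => stratQ (ρ j.1) (H j.1) (R j.1) (O j.1) j.2 Set.univ)
    (fun j => isQ_strat _ _ _ _ _ _) (isQ_norm (K := K))
  refine ⟨N, hN, ⟨c, C, hc, hcC, hcN⟩, fun f fr hfr => ?_⟩
  obtain ⟨h0, hj⟩ := hdef f fr hfr
  have hC0 : 0 < C := hc.trans_le hcC
  suffices h : Tendsto (fun r => ‖f - fr r‖) atTop (𝓝 0) by
    refine squeeze_zero (fun r => hN.1 _) (fun r => (hcN (f - fr r)).2) ?_
    simpa using h.const_mul C
  by_cases hf : f = 0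
  · subst hf
    have := tendsto_sqrt_of_defect (isQ_norm (K := K)) h0
    simpa [Real.sqrt_sq (norm_nonneg _)] using this
  · rw [Metric.tendsto_atTop]
    intro ε hε
    have hη : 0 < ε / 6 := by positivity
    obtain ⟨δ, hδ, hδ'⟩ := exists_delta hmet hlsc f (η := ε / 6 / 2) (by positivity)
    obtain ⟨q, hq⟩ := exists_nat_one_div_lt hδ
    obtain ⟨ξ, hξ⟩ : ∃ ξ, ∀ x, ρ q x ≤ ξ := by
      obtain ⟨ξ, hξ⟩ := Ordinal.bddAbove_of_small (s := Set.range (ρ q))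
      exact ⟨ξ, fun x => hξ ⟨x, rfl⟩⟩
    have hgood := all_good (hD q) hη
      (fun x y hxy => (hδ' x y ((hd q x y hxy).trans_lt hq)).le) ξ Set.univ isClosed_univ
      (fun x _ => hξ x)
    obtain ⟨τ, hτ⟩ := hgood.exists_strat (hD q) hf hη isClosed_univ
    obtain ⟨r₀, hr₀⟩ := eventually_atTop.1 (hτ fr (hj (q, τ)))
    refine ⟨r₀, fun r hr => ?_⟩
    have h1 : ‖f - fr r‖ ≤ 3 * (ε / 6) := by
      rw [ContinuousMap.norm_le _ (by positivity)]
      intro x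
      rw [ContinuousMap.sub_apply, Real.norm_eq_abs, abs_sub_comm]
      exact (hr₀ r hr x trivial).le
    rw [Real.dist_eq, sub_zero, abs_of_nonneg (norm_nonneg _)]
    linarith
end

section
/- Let (K,T) be a compact Hausdorff space and d a metric on K such that property P(d,T) holds. Then there is a norm ‖·‖ on C(K), equivalent to the supremum norm, which is locally uniformly convex at every f ∈ C(K) that is both T-continuous and d-uniformly continuous. -/
open Filter Topology

set_option linter.unusedSectionVars false

noncomputable section TC

variable {K : Type*} [TopologicalSpace K] [CompactSpace K]

/-- Nonnegative convex positively 2-homogeneous functionals dominated by the squared sup norm. -/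
structure QF (q : C(K, ℝ) → ℝ) : Prop where
  nonneg : ∀ f, 0 ≤ q f
  smul : ∀ (c : ℝ) f, 0 ≤ c → q (c • f) = c ^ 2 * q f
  conv : ∀ (a b : ℝ) f g, 0 ≤ a → 0 ≤ b → a + b = 1 → q (a • f + b • g) ≤ a * q f + b * q g
  le : ∀ f, q f ≤ ‖f‖ ^ 2

/-- Midpoint defect. -/
def df (q : C(K, ℝ) → ℝ) (f g : C(K, ℝ)) : ℝ :=
  1 / 2 * q f + 1 / 2 * q g - q ((1 / 2 : ℝ) • (f + g))

theorem QF.mid {q : C(K, ℝ) → ℝ} (h : QF q) (f g : C(K, ℝ)) :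
    q ((1 / 2 : ℝ) • (f + g)) ≤ 1 / 2 * q f + 1 / 2 * q g := by
  rw [smul_add]
  exact h.conv _ _ f g (by norm_num) (by norm_num) (by norm_num)

theorem QF.df_nonneg {q : C(K, ℝ) → ℝ} (h : QF q) (f g : C(K, ℝ)) : 0 ≤ df q f g := by
  have := h.mid f g
  unfold df
  linarith

theorem QF.of_sub {p : C(K, ℝ) → ℝ} (h0 : ∀ f, 0 ≤ p f)
    (h1 : ∀ (c : ℝ) f, 0 ≤ c → p (c • f) = c * p f) (h2 : ∀ f g, p (f + g) ≤ p f + p g)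
    (h3 : ∀ f, p f ≤ ‖f‖) : QF (fun f => p f ^ 2) where
  nonneg f := sq_nonneg _
  smul c f hc := by rw [h1 c f hc]; ring
  conv a b f g ha hb hab := by
    have h := h2 (a • f) (b • g)
    rw [h1 a f ha, h1 b g hb] at h
    have h' := h0 (a • f + b • g)
    have : p (a • f + b • g) ^ 2 ≤ (a * p f + b * p g) ^ 2 := by gcongr
    have hb' : b = 1 - a := by linarith
    subst hb'
    nlinarith [mul_nonneg (mul_nonneg ha hb) (sq_nonneg (p f - p g))]
  le f := by
    have := h0 f
    have := h3 f
    gcongr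

theorem QF.iSup {ι : Sort*} {q : ι → C(K, ℝ) → ℝ} (h : ∀ i, QF (q i)) :
    QF (fun f => ⨆ i, q i f) := by
  have bdd : ∀ f, BddAbove (Set.range fun i => q i f) := fun f =>
    ⟨‖f‖ ^ 2, by rintro _ ⟨i, rfl⟩; exact (h i).le f⟩
  have hn : ∀ f, 0 ≤ ⨆ i, q i f := fun f => Real.iSup_nonneg fun i => (h i).nonneg f
  constructor
  · exact hn
  · intro c f hc
    simp only [(h _).smul c f hc]
    rw [Real.mul_iSup_of_nonneg (by positivity)]
  · intro a b f g ha hb hab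
    refine Real.iSup_le (fun i => ?_) (by have := hn f; have := hn g; positivity)
    refine ((h i).conv a b f g ha hb hab).trans ?_
    have h1 := le_ciSup (bdd f) i
    have h2 := le_ciSup (bdd g) i
    gcongr
  · intro f
    exact Real.iSup_le (fun i => (h i).le f) (by positivity)

theorem QF.le_iSup {ι : Sort*} {q : ι → C(K, ℝ) → ℝ} (h : ∀ i, QF (q i)) (i : ι)
    (f : C(K, ℝ)) : q i f ≤ ⨆ i, q i f :=
  le_ciSup (f := fun i => q i f) ⟨‖f‖ ^ 2, by rintro _ ⟨i, rfl⟩; exact (h i).le f⟩ i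

theorem QF.comb {p q : C(K, ℝ) → ℝ} (hp : QF p) (hq : QF q) {α β : ℝ} (hα : 0 ≤ α)
    (hβ : 0 ≤ β) (hαβ : α + β ≤ 1) : QF (fun f => α * p f + β * q f) where
  nonneg f := by have := hp.nonneg f; have := hq.nonneg f; positivity
  smul c f hc := by simp only [hp.smul c f hc, hq.smul c f hc]; ring
  conv a b f g ha hb hab := by
    have h1 := mul_le_mul_of_nonneg_left (hp.conv a b f g ha hb hab) hα
    have h2 := mul_le_mul_of_nonneg_left (hq.conv a b f g ha hb hab) hβ
    linarith
  le f := by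
    have h1 := mul_le_mul_of_nonneg_left (hp.le f) hα
    have h2 := mul_le_mul_of_nonneg_left (hq.le f) hβ
    have h3 := mul_le_mul_of_nonneg_right hαβ (sq_nonneg ‖f‖)
    linarith

theorem df_comb (p q : C(K, ℝ) → ℝ) (α β : ℝ) (f g : C(K, ℝ)) :
    df (fun f => α * p f + β * q f) f g = α * df p f g + β * df q f g := by
  unfold df; ring

/-- summable weights -/
def wt (ι : Type*) [Encodable ι] (i : ι) : ℝ := (posSumOfEncodable (one_pos (α := ℝ)) ι).1 i

theorem wt_pos {ι : Type*} [Encodable ι] (i : ι) : 0 < wt ι i :=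
  (posSumOfEncodable (one_pos (α := ℝ)) ι).2.1 i

theorem wt_summable (ι : Type*) [Encodable ι] : Summable (wt ι) := by
  obtain ⟨c, hc, -⟩ := (posSumOfEncodable (one_pos (α := ℝ)) ι).2.2
  exact hc.summable

theorem wt_tsum (ι : Type*) [Encodable ι] : ∑' i, wt ι i ≤ 1 := by
  obtain ⟨c, hc, h⟩ := (posSumOfEncodable (one_pos (α := ℝ)) ι).2.2
  exact hc.tsum_eq.trans_le h

/-- weighted countable sum -/
def csum {ι : Type*} [Encodable ι] (q : ι → C(K, ℝ) → ℝ) (f : C(K, ℝ)) : ℝ :=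
  ∑' i, wt ι i * q i f

section
variable {ι : Type*} [Encodable ι] {q : ι → C(K, ℝ) → ℝ}

theorem csum_summable (h : ∀ i, QF (q i)) (f : C(K, ℝ)) :
    Summable fun i => wt ι i * q i f := by
  refine Summable.of_nonneg_of_le (fun i => mul_nonneg (wt_pos i).le ((h i).nonneg f))
    (fun i => mul_le_mul_of_nonneg_left ((h i).le f) (wt_pos i).le) ?_
  exact (wt_summable ι).mul_right _

theorem QF.csum (h : ∀ i, QF (q i)) : QF (csum q) where
  nonneg f := tsum_nonneg fun i => mul_nonneg (wt_pos i).le ((h i).nonneg f)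
  smul c f hc := by
    unfold _root_.csum
    rw [← tsum_mul_left]
    congr 1; ext i
    rw [(h i).smul c f hc]; ring
  conv a b f g ha hb hab := by
    unfold _root_.csum
    rw [← tsum_mul_left, ← tsum_mul_left,
      ← ((csum_summable h f).mul_left a).tsum_add ((csum_summable h g).mul_left b)]
    refine (csum_summable h _).tsum_le_tsum (fun i => ?_)
      (((csum_summable h f).mul_left a).add ((csum_summable h g).mul_left b))
    have := mul_le_mul_of_nonneg_left ((h i).conv a b f g ha hb hab) (wt_pos i).le
    linarith
  le f := by
    unfold _root_.csum
    calc ∑' i, wt ι i * q i f ≤ ∑' i, wt ι i * ‖f‖ ^ 2 :=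
          (csum_summable h f).tsum_le_tsum
            (fun i => mul_le_mul_of_nonneg_left ((h i).le f) (wt_pos i).le)
            ((wt_summable ι).mul_right _)
      _ = (∑' i, wt ι i) * ‖f‖ ^ 2 := tsum_mul_right
      _ ≤ 1 * ‖f‖ ^ 2 := by gcongr; exact wt_tsum ι
      _ = _ := one_mul _

theorem le_csum (h : ∀ i, QF (q i)) (i : ι) (f : C(K, ℝ)) : wt ι i * q i f ≤ csum q f :=
  (csum_summable h f).le_tsum i fun j _ => mul_nonneg (wt_pos j).le ((h j).nonneg f)

theorem df_csum (h : ∀ i, QF (q i)) (i : ι) (f g : C(K, ℝ)) :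
    wt ι i * df (q i) f g ≤ df (csum q) f g := by
  have s1 := (csum_summable h f).mul_left (1 / 2)
  have s2 := (csum_summable h g).mul_left (1 / 2)
  have s3 := csum_summable h ((1 / 2 : ℝ) • (f + g))
  have : df (csum q) f g = ∑' i, wt ι i * df (q i) f g := by
    unfold df csum
    rw [← tsum_mul_left, ← tsum_mul_left, ← s1.tsum_add s2, ← (s1.add s2).tsum_sub s3]
    congr 1; ext i; ring
  rw [this]
  have s4 : Summable fun i => wt ι i * df (q i) f g := by
    refine ((s1.add s2).sub s3).congr fun i => ?_
    unfold df; ring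
  exact s4.le_tsum i fun j _ => mul_nonneg (wt_pos j).le ((h j).df_nonneg f g)

theorem tendsto_df_csum (h : ∀ i, QF (q i)) (i : ι) {f : C(K, ℝ)} {xr : ℕ → C(K, ℝ)}
    (ht : Tendsto (fun r => df (csum q) f (xr r)) atTop (𝓝 0)) :
    Tendsto (fun r => df (q i) f (xr r)) atTop (𝓝 0) := by
  have h2 : Tendsto (fun r => (wt ι i)⁻¹ * df (csum q) f (xr r)) atTop (𝓝 0) := by
    simpa using ht.const_mul (wt ι i)⁻¹
  refine squeeze_zero (fun r => (h i).df_nonneg _ _) (fun r => ?_) h2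
  rw [inv_mul_eq_div, le_div_iff₀ (wt_pos i), mul_comm]
  exact df_csum h i _ _
end

theorem QF.sqrt_add {q : C(K, ℝ) → ℝ} (h : QF q) (f g : C(K, ℝ)) :
    √(q (f + g)) ≤ √(q f) + √(q g) := by
  have key : ∀ a b : ℝ, √(q f) < a → √(q g) < b → √(q (f + g)) ≤ a + b := by
    intro a b ha hb
    have ha0 : 0 < a := (Real.sqrt_nonneg _).trans_lt ha
    have hb0 : 0 < b := (Real.sqrt_nonneg _).trans_lt hb
    have hab : 0 < a + b := by positivity
    apply Real.sqrt_le_iff.2 ⟨hab.le, ?_⟩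
    have hfa : q f ≤ a ^ 2 := ((Real.sqrt_lt' ha0).1 ha).le
    have hgb : q g ≤ b ^ 2 := ((Real.sqrt_lt' hb0).1 hb).le
    have e : f + g = (a + b) • ((a / (a + b)) • (a⁻¹ • f) + (b / (a + b)) • (b⁻¹ • g)) := by
      rw [smul_add, smul_smul, smul_smul, smul_smul, smul_smul]
      have e1 : (a + b) * (a / (a + b)) * a⁻¹ = 1 := by field_simp
      have e2 : (a + b) * (b / (a + b)) * b⁻¹ = 1 := by field_simp
      rw [e1, e2, one_smul, one_smul]
    rw [e, h.smul _ _ hab.le]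
    have h1 := h.conv (a / (a + b)) (b / (a + b)) (a⁻¹ • f) (b⁻¹ • g) (by positivity)
      (by positivity) (by field_simp)
    have h2 : q (a⁻¹ • f) ≤ 1 := by
      rw [h.smul _ _ (by positivity), inv_pow, inv_mul_le_iff₀ (by positivity)]; linarith
    have h3 : q (b⁻¹ • g) ≤ 1 := by
      rw [h.smul _ _ (by positivity), inv_pow, inv_mul_le_iff₀ (by positivity)]; linarith
    have h4 : a / (a + b) * q (a⁻¹ • f) + b / (a + b) * q (b⁻¹ • g) ≤ 1 := by
      calc _ ≤ a / (a + b) * 1 + b / (a + b) * 1 := by gcongr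
        _ = 1 := by field_simp
    calc (a + b) ^ 2 * _ ≤ (a + b) ^ 2 * 1 := by gcongr; exact h1.trans h4
      _ = _ := mul_one _
  refine le_of_forall_pos_le_add fun ε hε => ?_
  have := key (√(q f) + ε / 2) (√(q g) + ε / 2) (by linarith) (by linarith)
  linarith

/-- The defect controls the difference of square roots. -/
theorem QF.df_ge {q : C(K, ℝ) → ℝ} (h : QF q) (f g : C(K, ℝ)) :
    1 / 4 * (√(q f) - √(q g)) ^ 2 ≤ df q f g := by
  have h1 := h.sqrt_add f g
  have h2 : √(q (f + g)) ^ 2 ≤ (√(q f) + √(q g)) ^ 2 := by gcongr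
  rw [Real.sq_sqrt (h.nonneg _)] at h2
  unfold df
  rw [h.smul _ _ (by norm_num)]
  have e1 := Real.sq_sqrt (h.nonneg f)
  have e2 := Real.sq_sqrt (h.nonneg g)
  nlinarith

/-- Selection lemma. -/
theorem select {I : Type*} {φ ψ : I → C(K, ℝ) → ℝ} (hφ : ∀ i, QF (φ i)) (hψ : ∀ i, QF (ψ i))
    {f : C(K, ℝ)} {xr : ℕ → C(K, ℝ)} (i0 : I) {δ : ℝ} (hδ : 0 < δ)
    (hgap : ∀ i, i ≠ i0 → φ i f ≤ φ i0 f - δ) {c : ℝ} (hc0 : 0 < c) (hc1 : c ≤ 1)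
    (hc : c * ‖f‖ ^ 2 ≤ δ / 2)
    (ht : Tendsto (fun r => df (fun g => ⨆ i, (1 / 2 * φ i g + c / 2 * ψ i g)) f (xr r)) atTop
      (𝓝 0)) :
    Tendsto (fun r => df (ψ i0) f (xr r)) atTop (𝓝 0) := by
  set ρ : I → C(K, ℝ) → ℝ := fun i g => 1 / 2 * φ i g + c / 2 * ψ i g with hρ
  have hQ : ∀ i, QF (ρ i) := fun i =>
    (hφ i).comb (hψ i) (by norm_num) (by positivity) (by linarith)
  set θ : C(K, ℝ) → ℝ := fun g => ⨆ i, ρ i g with hθ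
  have hle : ∀ i g, ρ i g ≤ θ g := fun i g => QF.le_iSup hQ i g
  have hg : ∀ i, i ≠ i0 → ρ i f ≤ θ f - δ / 4 := by
    intro i hi
    have h1 := hgap i hi
    have h2 := mul_le_mul_of_nonneg_left ((hψ i).le f) hc0.le
    have h3 := mul_nonneg hc0.le ((hψ i0).nonneg f)
    have h4 := hle i0 f
    simp only [hρ] at h4 ⊢
    linarith
  have hev : ∀ᶠ r in atTop, df (θ) f (xr r) < δ / 16 :=
    ht.eventually (gt_mem_nhds (by positivity))
  have hmain : ∀ᶠ r in atTop, df (ρ i0) f (xr r) ≤ df θ f (xr r) := by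
    filter_upwards [hev] with r hr
    have hothers : ∀ i, i ≠ i0 →
        ρ i ((1 / 2 : ℝ) • (f + xr r)) ≤ θ ((1 / 2 : ℝ) • (f + xr r)) - δ / 16 := by
      intro i hi
      have h1 := (hQ i).mid f (xr r)
      have h2 := hg i hi
      have h3 := hle i (xr r)
      unfold df at hr
      linarith
    have heq : θ ((1 / 2 : ℝ) • (f + xr r)) ≤ ρ i0 ((1 / 2 : ℝ) • (f + xr r)) := by
      by_contra! hlt
      have : θ ((1 / 2 : ℝ) • (f + xr r)) ≤
          max (ρ i0 ((1 / 2 : ℝ) • (f + xr r))) (θ ((1 / 2 : ℝ) • (f + xr r)) - δ / 16) := by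
        have : Nonempty I := ⟨i0⟩
        refine ciSup_le fun i => ?_
        by_cases hi : i = i0
        · subst hi; exact le_max_left _ _
        · exact (hothers i hi).trans (le_max_right _ _)
      rcases le_max_iff.1 this with h | h <;> linarith
    have h1 := hle i0 f
    have h2 := hle i0 (xr r)
    unfold df
    linarith
  have hlim : Tendsto (fun r => (2 / c) * df θ f (xr r)) atTop (𝓝 0) := by
    simpa using ht.const_mul (2 / c)
  refine squeeze_zero' (Eventually.of_forall fun r => (hψ i0).df_nonneg _ _) ?_ hlim
  filter_upwards [hmain] with r hr
  have h1 := df_comb (φ i0) (ψ i0) (1 / 2) (c / 2) f (xr r)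
  have h2 := (hφ i0).df_nonneg f (xr r)
  have h3 : c / 2 * df (ψ i0) f (xr r) ≤ df θ f (xr r) := by
    have : df (ρ i0) f (xr r) = _ := h1
    linarith
  have : (2 / c) * (c / 2 * df (ψ i0) f (xr r)) ≤ 2 / c * df θ f (xr r) := by gcongr
  calc _ = (2 / c) * (c / 2 * df (ψ i0) f (xr r)) := by field_simp
    _ ≤ _ := this

/-- pseudo-distance attached to a finite list of functions -/
def ee (l : List C(K, ℝ)) (t u : K) : ℝ := (l.map fun g => |g t - g u|).sum

section ee

theorem ee_nonneg (l : List C(K, ℝ)) (t u : K) : 0 ≤ ee l t u := by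
  induction l with
  | nil => simp [ee]
  | cons a l ih => simp only [ee, List.map_cons, List.sum_cons] at ih ⊢; positivity

theorem ee_self (l : List C(K, ℝ)) (t : K) : ee l t t = 0 := by
  induction l with
  | nil => simp [ee]
  | cons a l ih => simp only [ee, List.map_cons, List.sum_cons] at ih ⊢; simp

theorem ee_comm (l : List C(K, ℝ)) (t u : K) : ee l t u = ee l u t := by
  simp only [ee, abs_sub_comm]

theorem ee_tri (l : List C(K, ℝ)) (t u v : K) : ee l t v ≤ ee l t u + ee l u v := by
  induction l with
  | nil => simp [ee]
  | cons a l ih =>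
    simp only [ee, List.map_cons, List.sum_cons] at ih ⊢
    have := abs_sub_le (a t) (a u) (a v)
    linarith

theorem ee_append (l m : List C(K, ℝ)) (t u : K) : ee (l ++ m) t u = ee l t u + ee m t u := by
  simp [ee]

theorem ee_cont (l : List C(K, ℝ)) : Continuous fun p : K × K => ee l p.1 p.2 := by
  induction l with
  | nil => simp only [ee, List.map_nil, List.sum_nil]; exact continuous_const
  | cons a l ih => simp only [ee, List.map_cons, List.sum_cons] at ih ⊢; fun_prop
end ee

theorem exists_net [Nonempty K] (l : List C(K, ℝ)) (η : ℝ) (hη : 0 < η) :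
    ∃ F : Finset K, ∀ t, ∃ u ∈ F, ee l t u < η := by
  obtain ⟨F, hF⟩ := isCompact_univ.elim_finite_subcover
    (fun u : K => {t | ee l t u < η})
    (fun u => isOpen_lt ((ee_cont l).comp (Continuous.prodMk_left u)) continuous_const)
    (fun t _ => Set.mem_iUnion.2 ⟨t, by simp [ee_self, hη]⟩)
  refine ⟨F, fun t => ?_⟩
  simpa using hF (Set.mem_univ t)

theorem exists_pt [Nonempty K] (l : List C(K, ℝ)) :
    ∃ pt : ℕ → K, ∀ t, ∀ η : ℝ, 0 < η → ∃ n, ee l t (pt n) < η := by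
  choose F hF using fun n : ℕ => exists_net l (1 / ((n : ℝ) + 1)) (by positivity)
  have hc : (⋃ n, (F n : Set K)).Countable :=
    Set.countable_iUnion fun n => (F n).countable_toSet
  have hne : (⋃ n, (F n : Set K)).Nonempty := by
    obtain ⟨u, hu, -⟩ := hF 0 (Classical.arbitrary K)
    exact ⟨u, Set.mem_iUnion.2 ⟨0, hu⟩⟩
  obtain ⟨pt, hpt⟩ := hc.exists_eq_range hne
  refine ⟨pt, fun t η hη => ?_⟩
  obtain ⟨n, hn⟩ := exists_nat_one_div_lt hη
  obtain ⟨u, hu, h⟩ := hF n t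
  have : u ∈ Set.range pt := hpt ▸ Set.mem_iUnion.2 ⟨n, hu⟩
  obtain ⟨k, rfl⟩ := this
  exact ⟨k, h.trans hn⟩

/-- countable sequence dense for `ee l` -/
def pt [Nonempty K] (l : List C(K, ℝ)) : ℕ → K := (exists_pt l).choose

theorem pt_spec [Nonempty K] (l : List C(K, ℝ)) (t : K) {η : ℝ} (hη : 0 < η) :
    ∃ n, ee l t (pt l n) < η := (exists_pt l).choose_spec t η hη

/-- A countable system of relatively discrete families covering the space. -/
structure Sys (K : Type*) [TopologicalSpace K] where
  A : ℕ → Set K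
  U : ℕ → K → Set K
  closed : ∀ i, IsClosed (A i)
  isOpen : ∀ i x, IsOpen (U i x)
  disj : ∀ i x y t, t ∈ A i → t ∈ U i x → t ∈ U i y → x = y
  cover : ∀ t, ∃ i x, t ∈ A i ∧ t ∈ U i x

namespace Sys

/-- remainder of the `i`th family -/
def B (S : Sys K) (i : ℕ) : Set K := S.A i \ ⋃ x, S.U i x

theorem B_closed (S : Sys K) (i : ℕ) : IsClosed (S.B i) :=
  (S.closed i).sdiff (isOpen_iUnion fun x => S.isOpen i x)

/-- closed sets used for localisation -/
def X (S : Sys K) (i : ℕ) (J : Finset ℕ) : Set K := S.A i ∩ ⋂ j ∈ J, S.B j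

theorem X_closed (S : Sys K) (i : ℕ) (J : Finset ℕ) : IsClosed (S.X i J) :=
  (S.closed i).inter (isClosed_biInter fun j _ => S.B_closed j)

/-- union of finitely many members -/
def D (S : Sys K) (i : ℕ) (M : Finset K) : Set K := ⋃ x ∈ M, S.A i ∩ S.U i x

end Sys

theorem Sys.exists_min (S : Sys K) {Q : Set K} (hQ : IsClosed Q) (hne : Q.Nonempty) :
    ∃ i J, (Q ∩ S.X i J).Nonempty ∧ Q ∩ S.X i J ∩ S.B i = ∅ := by
  have hQc : IsCompact Q := hQ.isCompact
  have hz := zorn_subset {J : Set ℕ | (Q ∩ ⋂ j ∈ J, S.B j).Nonempty} (by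
    intro c hc hchain
    refine ⟨⋃₀ c, ?_, fun s hs => Set.subset_sUnion_of_mem hs⟩
    by_cases hcn : c.Nonempty
    · have : Nonempty c := hcn.to_subtype
      have h := IsCompact.nonempty_iInter_of_directed_nonempty_isCompact_isClosed
        (fun J : c => Q ∩ ⋂ j ∈ J.1, S.B j) (by
          intro a b
          rcases hchain.total a.2 b.2 with h | h
          · exact ⟨b, Set.inter_subset_inter_right _ (Set.biInter_subset_biInter_left h), subset_rfl⟩
          · exact ⟨a, subset_rfl, Set.inter_subset_inter_right _ (Set.biInter_subset_biInter_left h)⟩)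
        (fun J => hc J.2)
        (fun J => hQc.inter_right (isClosed_biInter fun j _ => S.B_closed j))
        (fun J => hQ.inter (isClosed_biInter fun j _ => S.B_closed j))
      obtain ⟨t, ht⟩ := h
      rw [Set.mem_iInter] at ht
      refine ⟨t, (ht (Classical.arbitrary _)).1, ?_⟩
      simp only [Set.mem_iInter]
      rintro j ⟨J, hJ, hj⟩
      have := (ht ⟨J, hJ⟩).2
      simp only [Set.mem_iInter] at this
      exact this j hj
    · rw [Set.not_nonempty_iff_eq_empty] at hcn
      subst hcn
      simpa using hne)
  obtain ⟨J, hJ⟩ := hz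
  obtain ⟨t, htQ, htJ⟩ := hJ.prop
  obtain ⟨i, x, hA, hU⟩ := S.cover t
  have hempty : (Q ∩ S.B i) ∩ ⋂ j : J, S.B j = ∅ := by
    by_contra hcon
    rw [← Ne, ← Set.nonempty_iff_ne_empty] at hcon
    obtain ⟨u, ⟨huQ, huB⟩, huJ⟩ := hcon
    have hmem : insert i J ∈ {J : Set ℕ | (Q ∩ ⋂ j ∈ J, S.B j).Nonempty} := by
      refine ⟨u, huQ, ?_⟩
      simp only [Set.mem_iInter, Set.mem_insert_iff, Subtype.forall] at huJ ⊢
      rintro j (rfl | hj)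
      · exact huB
      · exact huJ j hj
    have hi : i ∈ J := hJ.le_of_ge hmem (Set.subset_insert i J) (Set.mem_insert i J)
    simp only [Set.mem_iInter] at htJ
    exact (htJ i hi).2 (Set.mem_iUnion.2 ⟨x, hU⟩)
  obtain ⟨F, hF⟩ := (hQc.inter_right (S.B_closed i)).elim_finite_subfamily_closed
    (fun j : J => S.B j) (fun j => S.B_closed j) hempty
  classical
  refine ⟨i, F.image Subtype.val, ⟨t, htQ, hA, ?_⟩, ?_⟩
  · simp only [Set.mem_iInter] at htJ ⊢
    intro j hj
    obtain ⟨j', -, rfl⟩ := Finset.mem_image.1 hj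
    exact htJ _ j'.2
  · rw [Set.eq_empty_iff_forall_notMem] at hF ⊢
    rintro u ⟨⟨huQ, huX⟩, huB⟩
    refine hF u ⟨⟨huQ, huB⟩, ?_⟩
    have := huX.2
    simp only [Set.mem_iInter] at this ⊢
    intro j hj
    exact this _ (Finset.mem_image_of_mem _ hj)

/-- Finite family covering `Q ∩ X`, together with an open set isolating it. -/
theorem Sys.exists_fin (S : Sys K) {Q : Set K} (hQ : IsClosed Q) (hne : Q.Nonempty) :
    ∃ i J, ∃ M : Finset K, ∃ V : Set K, IsOpen V ∧ Q ⊆ V ∧ V ∩ S.X i J ⊆ S.D i M ∧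
      (Q ∩ S.X i J).Nonempty ∧ ∀ x ∈ M, (Q ∩ S.X i J ∩ S.U i x).Nonempty := by
  obtain ⟨i, J, h1, h2⟩ := S.exists_min hQ hne
  have hc : IsCompact (Q ∩ S.X i J) := (hQ.inter (S.X_closed i J)).isCompact
  obtain ⟨F, hF⟩ := hc.elim_finite_subcover (S.U i) (S.isOpen i) (by
    intro t ht
    by_contra hcon
    have : t ∈ Q ∩ S.X i J ∩ S.B i := ⟨ht, ht.2.1, hcon⟩
    rw [h2] at this
    exact this)
  classical
  let M := F.filter fun x => (Q ∩ S.X i J ∩ S.U i x).Nonempty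
  have hM : Q ∩ S.X i J ⊆ ⋃ x ∈ M, S.U i x := by
    intro t ht
    obtain ⟨x, hx, htx⟩ := Set.mem_iUnion₂.1 (hF ht)
    exact Set.mem_iUnion₂.2 ⟨x, Finset.mem_filter.2 ⟨hx, t, ht, htx⟩, htx⟩
  refine ⟨i, J, M, (S.X i J \ ⋃ x ∈ M, S.U i x)ᶜ, ?_, ?_, ?_, h1, ?_⟩
  · exact ((S.X_closed i J).sdiff (isOpen_biUnion fun x _ => S.isOpen i x)).isOpen_compl
  · rintro t ht ⟨hX, hn⟩
    exact hn (hM ⟨ht, hX⟩)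
  · rintro t ⟨ht, hX⟩
    by_contra hcon
    refine ht ⟨hX, fun h => hcon ?_⟩
    obtain ⟨x, hx, htx⟩ := Set.mem_iUnion₂.1 h
    exact Set.mem_iUnion₂.2 ⟨x, hx, hX.1, htx⟩
  · intro x hx
    exact (Finset.mem_filter.1 hx).2

theorem QF.neg {q : C(K, ℝ) → ℝ} (h : QF q) : QF (fun f => q (-f)) where
  nonneg f := h.nonneg _
  smul c f hc := by rw [← smul_neg, h.smul c _ hc]
  conv a b f g ha hb hab := by
    have := h.conv a b (-f) (-g) ha hb hab
    rwa [smul_neg, smul_neg, ← neg_add] at this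
  le f := by simpa using h.le (-f)

theorem QF.avg {κ : Type*} (M : Finset κ) {q : κ → C(K, ℝ) → ℝ} (h : ∀ x, QF (q x)) (n : ℕ)
    (hn : M.card = n) : QF (fun f => 1 / ((n : ℝ) + 1) * ∑ x ∈ M, q x f) where
  nonneg f := by have := Finset.sum_nonneg fun x (_ : x ∈ M) => (h x).nonneg f; positivity
  smul c f hc := by
    simp only [(h _).smul c f hc, ← Finset.mul_sum]; ring
  conv a b f g ha hb hab := by
    have h1 := Finset.sum_le_sum fun x (_ : x ∈ M) => (h x).conv a b f g ha hb hab
    rw [Finset.sum_add_distrib, ← Finset.mul_sum, ← Finset.mul_sum] at h1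
    have h2 := mul_le_mul_of_nonneg_left h1 (show (0 : ℝ) ≤ 1 / ((n : ℝ) + 1) by positivity)
    linarith
  le f := by
    have h1 := Finset.sum_le_sum fun x (_ : x ∈ M) => (h x).le f
    rw [Finset.sum_const, hn, nsmul_eq_mul] at h1
    have h3 := sq_nonneg ‖f‖
    rw [one_div, inv_mul_le_iff₀ (by positivity)]
    linarith

theorem cm_abs_le (f : C(K, ℝ)) (t : K) : |f t| ≤ ‖f‖ := f.norm_coe_le_norm t

theorem cm_add_nonneg (f : C(K, ℝ)) (t : K) : 0 ≤ f t + ‖f‖ := by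
  have := (abs_le.1 (cm_abs_le f t)).1; linarith

/-- squared local supremum -/
def vv (Y : Set K) (f : C(K, ℝ)) : ℝ := ⨆ t : Y, ((f t + ‖f‖) / 2) ^ 2

theorem QF_pt (t : K) : QF (fun f : C(K, ℝ) => ((f t + ‖f‖) / 2) ^ 2) := by
  refine QF.of_sub (fun f => ?_) (fun c f hc => ?_) (fun f g => ?_) (fun f => ?_)
  · have := cm_add_nonneg f t; positivity
  · simp only [ContinuousMap.smul_apply, smul_eq_mul, norm_smul, Real.norm_eq_abs, abs_of_nonneg hc]
    ring
  · have := norm_add_le f g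
    simp only [ContinuousMap.add_apply]
    linarith
  · have := (abs_le.1 (cm_abs_le f t)).2
    linarith

theorem QF_vv (Y : Set K) : QF (vv (K := K) Y) := QF.iSup fun t : Y => QF_pt t.1

theorem vv_gap {Y : K → Set K} {M : Finset K} {f : C(K, ℝ)} {b δ : ℝ} (hb : 0 < b + ‖f‖)
    (hδ : 0 < δ) (h1 : ∀ x ∈ M, ∃ t ∈ Y x, f t = b) (h2 : ∀ x, x ∉ M → ∀ t ∈ Y x, f t ≤ b - δ) :
    ∃ β δ' : ℝ, 0 < δ' ∧ (∀ x ∈ M, β ≤ vv (Y x) f) ∧ ∀ x, x ∉ M → vv (Y x) f ≤ β - δ' := by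
  refine ⟨((b + ‖f‖) / 2) ^ 2, ((b + ‖f‖) / 2) ^ 2 - (max (b - δ + ‖f‖) 0 / 2) ^ 2, ?_, ?_, ?_⟩
  · have h3 : max (b - δ + ‖f‖) 0 < b + ‖f‖ := max_lt (by linarith) hb
    have h4 : 0 ≤ max (b - δ + ‖f‖) 0 := le_max_right _ _
    have : (max (b - δ + ‖f‖) 0 / 2) ^ 2 < ((b + ‖f‖) / 2) ^ 2 := by gcongr
    linarith
  · intro x hx
    obtain ⟨t, ht, rfl⟩ := h1 x hx
    exact QF.le_iSup (q := fun (t : Y x) (f : C(K, ℝ)) => ((f t + ‖f‖) / 2) ^ 2)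
      (fun t => QF_pt t.1) ⟨t, ht⟩ f
  · intro x hx
    rw [sub_sub_cancel]
    refine Real.iSup_le (fun t => ?_) (by positivity)
    have h3 := h2 x hx t t.2
    have h4 := cm_add_nonneg f t
    have h5 : f t + ‖f‖ ≤ max (b - δ + ‖f‖) 0 := le_max_of_le_left (by linarith)
    gcongr

theorem sum_gap {κ : Type*} {v : κ → ℝ} {M0 M : Finset κ} {β δ : ℝ} (hδ : 0 < δ)
    (hc : M.card = M0.card)
    (h1 : ∀ x ∈ M0, β ≤ v x) (h2 : ∀ x, x ∉ M0 → v x ≤ β - δ) (hne : M ≠ M0) :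
    ∑ x ∈ M, v x ≤ ∑ x ∈ M0, v x - δ := by
  classical
  have e1 := Finset.sum_inter_add_sum_sdiff M M0 v
  have e2 := Finset.sum_inter_add_sum_sdiff M0 M v
  rw [Finset.inter_comm] at e2
  have hc' : (M \ M0).card = (M0 \ M).card := by
    have a1 := Finset.card_inter_add_card_sdiff M M0
    have a2 := Finset.card_inter_add_card_sdiff M0 M
    rw [Finset.inter_comm] at a2
    omega
  have hpos : 1 ≤ (M \ M0).card := by
    rw [Nat.one_le_iff_ne_zero, Ne, Finset.card_eq_zero, Finset.sdiff_eq_empty_iff_subset]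
    intro hs
    exact hne (Finset.eq_of_subset_of_card_le hs hc.ge)
  have s1 : ∑ x ∈ M \ M0, v x ≤ (M \ M0).card • (β - δ) :=
    Finset.sum_le_card_nsmul _ _ _ fun x hx => h2 x (Finset.mem_sdiff.1 hx).2
  have s2 : (M0 \ M).card • β ≤ ∑ x ∈ M0 \ M, v x :=
    Finset.card_nsmul_le_sum _ _ _ fun x hx => h1 x (Finset.mem_sdiff.1 hx).1
  rw [nsmul_eq_mul] at s1 s2
  rw [← hc'] at s2
  have hpos' : (1 : ℝ) ≤ ((M \ M0).card : ℝ) := by exact_mod_cast hpos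
  nlinarith

/-- oscillation functional -/
def osc (l : List C(K, ℝ)) (m : ℕ) (f : C(K, ℝ)) : ℝ :=
  ⨆ p : {p : K × K // ee l p.1 p.2 ≤ 1 / ((m : ℝ) + 1)}, (|f p.1.1 - f p.1.2| / 2) ^ 2

theorem QF_pair (t u : K) : QF (fun f : C(K, ℝ) => (|f t - f u| / 2) ^ 2) := by
  refine QF.of_sub (fun f => by positivity) (fun c f hc => ?_) (fun f g => ?_) (fun f => ?_)
  · simp only [ContinuousMap.smul_apply, smul_eq_mul, ← mul_sub, abs_mul, abs_of_nonneg hc]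
    ring
  · have := abs_add_le (f t - f u) (g t - g u)
    simp only [ContinuousMap.add_apply]
    rw [show f t + g t - (f u + g u) = f t - f u + (g t - g u) by ring]
    linarith
  · have h1 := cm_abs_le f t
    have h2 := cm_abs_le f u
    have := abs_sub (f t) (f u)
    linarith

theorem QF_osc (l : List C(K, ℝ)) (m : ℕ) : QF (osc l m) :=
  QF.iSup fun p : {p : K × K // ee l p.1 p.2 ≤ 1 / ((m : ℝ) + 1)} => QF_pair p.1.1 p.1.2

theorem QF_ev (t : K) : QF (fun f : C(K, ℝ) => |f t| ^ 2) := by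
  refine QF.of_sub (fun f => by positivity) (fun c f hc => ?_) (fun f g => ?_) (fun f => ?_)
  · simp only [ContinuousMap.smul_apply, smul_eq_mul, abs_mul, abs_of_nonneg hc]
  · exact abs_add_le _ _
  · exact cm_abs_le f t

theorem QF_norm : QF (fun f : C(K, ℝ) => ‖f‖ ^ 2) := by
  refine QF.of_sub (fun f => by positivity) (fun c f hc => ?_) (fun f g => ?_) (fun f => le_rfl)
  · rw [norm_smul, Real.norm_eq_abs, abs_of_nonneg hc]
  · exact norm_add_le _ _

open Classical in
/-- separating function attached to two finite subfamilies -/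
def hh (S : Sys K) (i i' : ℕ) (M M' : Finset K) : C(K, ℝ) :=
  if h : ∃ h : C(K, ℝ), (∀ t ∈ S.D i M, h t = 1) ∧ ∀ t ∈ S.D i' M', h t = 0 then h.choose else 0

theorem hh_spec (S : Sys K) (i i' : ℕ) (M M' : Finset K)
    (h : ∃ h : C(K, ℝ), (∀ t ∈ S.D i M, h t = 1) ∧ ∀ t ∈ S.D i' M', h t = 0) :
    (∀ t ∈ S.D i M, hh S i i' M M' t = 1) ∧ ∀ t ∈ S.D i' M', hh S i i' M M' t = 0 := by
  unfold hh
  rw [dif_pos h]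
  exact h.choose_spec

/-- localisation set -/
def YY [Nonempty K] (S : Sys K) (l : List C(K, ℝ)) (n m i : ℕ) (J : Finset ℕ) (x : K) : Set K :=
  {t | t ∈ S.U i x ∧ t ∈ S.X i J ∧ ee l t (pt l n) ≤ 1 / ((m : ℝ) + 1)}

/-- selecting functional -/
def ph [Nonempty K] (S : Sys K) (l : List C(K, ℝ)) (n m i i' : ℕ) (J J' : Finset ℕ) (q q' : ℕ)
    (M : {M : Finset K // M.card = q} × {M : Finset K // M.card = q'}) (f : C(K, ℝ)) : ℝ :=
  1 / 2 * (1 / ((q : ℝ) + 1) * ∑ x ∈ M.1.1, vv (YY S l n m i J x) f) +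
  1 / 2 * (1 / ((q' : ℝ) + 1) * ∑ x ∈ M.2.1, vv (YY S l n m i' J' x) (-f))

theorem QF_ph [Nonempty K] (S : Sys K) (l : List C(K, ℝ)) (n m i i' : ℕ) (J J' : Finset ℕ)
    (q q' : ℕ) (M : {M : Finset K // M.card = q} × {M : Finset K // M.card = q'}) :
    QF (ph S l n m i i' J J' q q' M) :=
  QF.comb (QF.avg M.1.1 (fun x => QF_vv (YY S l n m i J x)) q M.1.2)
    (QF.avg M.2.1 (fun x => (QF_vv (YY S l n m i' J' x)).neg) q' M.2.2)
    (by norm_num) (by norm_num) (by norm_num)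

/-- recipes -/
abbrev Rcp := ℕ × ℕ × ℕ × ℕ × ℕ × Finset ℕ × Finset ℕ × ℕ × ℕ × ℕ

/-- The recursively defined functionals. -/
def NN [Nonempty K] (S : Sys K) : ℕ → List C(K, ℝ) → C(K, ℝ) → ℝ
  | 0, l => csum (ι := ℕ ⊕ ℕ) (Sum.elim (fun n f => |f (pt l n)| ^ 2) (fun m => osc l m))
  | s + 1, l => csum (ι := Rcp) (fun ρ f => match ρ with
    | (k, n, m, i, i', J, J', q, q', c) =>
      ⨆ M : {M : Finset K // M.card = q} × {M : Finset K // M.card = q'},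
        (1 / 2 * ph S (l.drop k) n m i i' J J' q q' M f +
          (1 / ((c : ℝ) + 1)) / 2 * NN S s (l ++ [hh S i i' M.1.1 M.2.1]) f))

theorem QF_NN0 [Nonempty K] (l : List C(K, ℝ)) (j : ℕ ⊕ ℕ) :
    QF (Sum.elim (fun n (f : C(K, ℝ)) => |f (pt l n)| ^ 2) (fun m => osc l m) j) := by
  rcases j with n | m
  · exact QF_ev _
  · exact QF_osc l m

theorem QF_NN [Nonempty K] (S : Sys K) (s : ℕ) (l : List C(K, ℝ)) : QF (NN S s l) := by
  induction s generalizing l with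
  | zero => exact QF.csum (QF_NN0 l)
  | succ s ih =>
    refine QF.csum fun ρ => ?_
    obtain ⟨k, n, m, i, i', J, J', q, q', c⟩ := ρ
    refine QF.iSup fun M => ?_
    have hc : (1 : ℝ) / ((c : ℝ) + 1) ≤ 1 := by
      rw [div_le_one (by positivity)]; linarith [(Nat.cast_nonneg c : (0 : ℝ) ≤ c)]
    exact (QF_ph S (l.drop k) n m i i' J J' q q' M).comb (ih _) (by norm_num) (by positivity)
      (by linarith)

/-- all functionals in context `l` have vanishing defect -/
def Good_s3 [Nonempty K] (S : Sys K) (f : C(K, ℝ)) (xr : ℕ → C(K, ℝ)) (l : List C(K, ℝ)) : Prop :=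
  ∀ s, Tendsto (fun r => df (NN S s l) f (xr r)) atTop (𝓝 0)

/-- `l` can be appended to any good context -/
def Reach [Nonempty K] (S : Sys K) (f : C(K, ℝ)) (xr : ℕ → C(K, ℝ)) (l : List C(K, ℝ)) : Prop :=
  ∀ l', Good_s3 S f xr l' → Good_s3 S f xr (l' ++ l)

theorem reach_nil [Nonempty K] (S : Sys K) (f : C(K, ℝ)) (xr : ℕ → C(K, ℝ)) :
    Reach S f xr [] := fun l' h => by simpa using h

theorem reach_append [Nonempty K] {S : Sys K} {f : C(K, ℝ)} {xr : ℕ → C(K, ℝ)}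
    {l m : List C(K, ℝ)} (hl : Reach S f xr l) (hm : Reach S f xr m) : Reach S f xr (l ++ m) := by
  intro l' h
  rw [← List.append_assoc]
  exact hm _ (hl _ h)

theorem reach_step [Nonempty K] {S : Sys K} {f : C(K, ℝ)} {xr : ℕ → C(K, ℝ)}
    {l : List C(K, ℝ)} (hl : Reach S f xr l) (n m i i' : ℕ) (J J' : Finset ℕ) (M M' : Finset K)
    {β δ β' δ' : ℝ} (hδ : 0 < δ) (hδ' : 0 < δ')
    (h1 : ∀ x ∈ M, β ≤ vv (YY S l n m i J x) f)
    (h2 : ∀ x, x ∉ M → vv (YY S l n m i J x) f ≤ β - δ)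
    (h3 : ∀ x ∈ M', β' ≤ vv (YY S l n m i' J' x) (-f))
    (h4 : ∀ x, x ∉ M' → vv (YY S l n m i' J' x) (-f) ≤ β' - δ') :
    Reach S f xr (l ++ [hh S i i' M M']) := by
  intro l' hl' s
  rw [← List.append_assoc]
  set q := M.card with hq
  set q' := M'.card with hq'
  let i0 : {M : Finset K // M.card = q} × {M : Finset K // M.card = q'} := (⟨M, rfl⟩, ⟨M', rfl⟩)
  set a : ℝ := 1 / 2 * (1 / ((q : ℝ) + 1)) with ha
  set a' : ℝ := 1 / 2 * (1 / ((q' : ℝ) + 1)) with ha'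
  have ha0 : 0 < a := by positivity
  have ha0' : 0 < a' := by positivity
  have hd0 : 0 < min (a * δ) (a' * δ') := lt_min (by positivity) (by positivity)
  have hgap : ∀ N, N ≠ i0 → ph S l n m i i' J J' q q' N f ≤
      ph S l n m i i' J J' q q' i0 f - min (a * δ) (a' * δ') := by
    rintro ⟨⟨N, hN⟩, ⟨N', hN'⟩⟩ hne
    have key : ∀ {N}, N.card = M.card → N ≠ M → a * ∑ x ∈ N, vv (YY S l n m i J x) f ≤
        a * ∑ x ∈ M, vv (YY S l n m i J x) f - a * δ := by
      intro N hN hne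
      rw [← mul_sub]
      exact mul_le_mul_of_nonneg_left (sum_gap hδ hN h1 h2 hne) ha0.le
    have key' : ∀ {N}, N.card = M'.card → N ≠ M' → a' * ∑ x ∈ N, vv (YY S l n m i' J' x) (-f) ≤
        a' * ∑ x ∈ M', vv (YY S l n m i' J' x) (-f) - a' * δ' := by
      intro N hN hne
      rw [← mul_sub]
      exact mul_le_mul_of_nonneg_left (sum_gap hδ' hN h3 h4 hne) ha0'.le
    have m1 := min_le_left (a * δ) (a' * δ')
    have m2 := min_le_right (a * δ) (a' * δ')
    have p1 : 0 < a * δ := by positivity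
    have p2 : 0 < a' * δ' := by positivity
    simp only [ph, ← mul_assoc, i0]
    rw [← ha, ← ha']
    by_cases e1 : N = M
    · by_cases e2 : N' = M'
      · exfalso; apply hne; subst e1 e2; rfl
      · have := key' hN' e2
        subst e1; linarith
    · have k1 := key hN e1
      by_cases e2 : N' = M'
      · subst e2; linarith
      · have := key' hN' e2
        linarith
  obtain ⟨c, hc⟩ : ∃ c : ℕ, 1 / ((c : ℝ) + 1) * ‖f‖ ^ 2 ≤ min (a * δ) (a' * δ') / 2 := by
    obtain ⟨c, hc⟩ := exists_nat_one_div_lt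
      (show 0 < min (a * δ) (a' * δ') / 2 / (‖f‖ ^ 2 + 1) by positivity)
    refine ⟨c, ?_⟩
    rw [lt_div_iff₀ (by positivity)] at hc
    have : 0 < 1 / ((c : ℝ) + 1) := by positivity
    linarith
  have hg := hl l' hl' (s + 1)
  have hc1 : (1 : ℝ) / ((c : ℝ) + 1) ≤ 1 := by
    rw [div_le_one (by positivity)]; linarith [(Nat.cast_nonneg c : (0 : ℝ) ≤ c)]
  have hcomp := tendsto_df_csum (ι := Rcp) (q := fun ρ f => match ρ with
    | (k, n, m, i, i', J, J', q, q', c) =>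
      ⨆ M : {M : Finset K // M.card = q} × {M : Finset K // M.card = q'},
        (1 / 2 * ph S ((l' ++ l).drop k) n m i i' J J' q q' M f +
          (1 / ((c : ℝ) + 1)) / 2 * NN S s ((l' ++ l) ++ [hh S i i' M.1.1 M.2.1]) f)) (by
      rintro ⟨k, n, m, i, i', J, J', q, q', c⟩
      refine QF.iSup fun M => ?_
      have hc : (1 : ℝ) / ((c : ℝ) + 1) ≤ 1 := by
        rw [div_le_one (by positivity)]; linarith [(Nat.cast_nonneg c : (0 : ℝ) ≤ c)]
      exact (QF_ph S _ n m i i' J J' q q' M).comb (QF_NN S s _) (by norm_num) (by positivity)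
        (by linarith)) (l'.length, n, m, i, i', J, J', q, q', c) hg
  simp only [List.drop_left] at hcomp
  exact select (fun N => QF_ph S l n m i i' J J' q q' N)
    (fun N => QF_NN S s ((l' ++ l) ++ [hh S i i' N.1.1 N.2.1])) i0 hd0 hgap
    (by positivity) hc1 hc hcomp

theorem cpt_aux {X : Type*} [TopologicalSpace X] [CompactSpace X] {R : List C(K, ℝ) → Prop}
    (h0 : R []) (happ : ∀ l m, R l → R m → R (l ++ m)) (Z : List C(K, ℝ) → ℕ → Set X)
    (hZ : ∀ l m, IsClosed (Z l m))
    (hmono : ∀ l l' m m', Z (l ++ l') (max m m') ⊆ Z l m ∩ Z l' m')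
    (hemp : ∀ x, ∃ l, R l ∧ ∃ m, x ∉ Z l m) : ∃ l, R l ∧ ∃ m, Z l m = ∅ := by
  by_contra! hcon
  have : Nonempty ({l // R l} × ℕ) := ⟨⟨⟨[], h0⟩, 0⟩⟩
  obtain ⟨x, hx⟩ := IsCompact.nonempty_iInter_of_directed_nonempty_isCompact_isClosed
    (fun j : {l // R l} × ℕ => Z j.1.1 j.2) (by
      rintro ⟨⟨l, hl⟩, m⟩ ⟨⟨l', hl'⟩, m'⟩
      exact ⟨⟨⟨l ++ l', happ _ _ hl hl'⟩, max m m'⟩,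
        (hmono l l' m m').trans Set.inter_subset_left,
        (hmono l l' m m').trans Set.inter_subset_right⟩)
    (fun j => hcon j.1.1 j.1.2 j.2) (fun j => (hZ _ _).isCompact) (fun j => hZ _ _)
  obtain ⟨l, hl, m, hm⟩ := hemp x
  exact hm (Set.mem_iInter.1 hx ⟨⟨l, hl⟩, m⟩)

theorem one_div_max_le (m m' : ℕ) : (1 : ℝ) / (((max m m' : ℕ) : ℝ) + 1) ≤ 1 / ((m : ℝ) + 1) ∧
    (1 : ℝ) / (((max m m' : ℕ) : ℝ) + 1) ≤ 1 / ((m' : ℝ) + 1) := by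
  have h1 : (m : ℝ) ≤ ((max m m' : ℕ) : ℝ) := by exact_mod_cast le_max_left m m'
  have h2 : (m' : ℝ) ≤ ((max m m' : ℕ) : ℝ) := by exact_mod_cast le_max_right m m'
  constructor <;> gcongr

theorem ee_cont_left (l : List C(K, ℝ)) (u : K) : Continuous fun t => ee l t u :=
  (ee_cont l).comp (Continuous.prodMk_left u)

theorem exists_osc [Nonempty K] [T2Space K] (S : Sys K) (f : C(K, ℝ)) (xr : ℕ → C(K, ℝ))
    {ε : ℝ} (hε : 0 < ε)
    (hf : ∀ i x t u, t ∈ S.A i → t ∈ S.U i x → u ∈ S.A i → u ∈ S.U i x → |f t - f u| ≤ ε) :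
    ∃ l, Reach S f xr l ∧ ∃ m : ℕ, ∀ t u, ee l t u ≤ 1 / ((m : ℝ) + 1) → |f t - f u| ≤ 3 * ε := by
  by_cases hsepd : ∃ t0 u0, (∀ l, Reach S f xr l → ee l t0 u0 = 0) ∧ 3 * ε ≤ |f t0 - f u0|
  swap
  · push Not at hsepd
    obtain ⟨l, hl, m, hm⟩ := cpt_aux (X := K × K) (R := Reach S f xr) (reach_nil S f xr)
      (fun l m => reach_append)
      (fun l m => {p | ee l p.1 p.2 ≤ 1 / ((m : ℝ) + 1)} ∩ {p | 3 * ε ≤ |f p.1 - f p.2|})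
      (fun l m => (isClosed_le (ee_cont l) continuous_const).inter
        (isClosed_le continuous_const (by fun_prop)))
      (by
        rintro l l' m m' ⟨t, u⟩ ⟨h1, h2⟩
        have h1' : ee (l ++ l') t u ≤ 1 / (((max m m' : ℕ) : ℝ) + 1) := h1
        rw [ee_append] at h1'
        have := one_div_max_le m m'
        have n1 := ee_nonneg l t u
        have n2 := ee_nonneg l' t u
        refine ⟨⟨?_, h2⟩, ⟨?_, h2⟩⟩
        · show ee l t u ≤ 1 / ((m : ℝ) + 1)
          linarith
        · show ee l' t u ≤ 1 / ((m' : ℝ) + 1)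
          linarith)
      (by
        rintro ⟨t, u⟩
        by_cases h : ∀ l, Reach S f xr l → ee l t u = 0
        · refine ⟨[], reach_nil S f xr, 0, fun hmem => ?_⟩
          have h1 : 3 * ε ≤ |f t - f u| := hmem.2
          linarith [hsepd t u h]
        · push Not at h
          obtain ⟨l, hl, hne⟩ := h
          have hpos : 0 < ee l t u := lt_of_le_of_ne (ee_nonneg _ _ _) (Ne.symm hne)
          obtain ⟨m, hm⟩ := exists_nat_one_div_lt hpos
          refine ⟨l, hl, m, fun hmem => ?_⟩
          have h1 : ee l t u ≤ 1 / ((m : ℝ) + 1) := hmem.1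
          linarith)
    refine ⟨l, hl, m, fun t u h => ?_⟩
    by_contra! hcon
    have : (t, u) ∈ (∅ : Set (K × K)) := hm ▸ ⟨h, hcon.le⟩
    exact this
  exfalso
  obtain ⟨t0, u0, hz, hd⟩ := hsepd
  let P : Set K := ⋂ (l) (_ : Reach S f xr l), {t | ee l t t0 = 0}
  have hPmem : ∀ t, t ∈ P ↔ ∀ l, Reach S f xr l → ee l t t0 = 0 := by
    intro t; simp [P]
  have hPc : IsClosed P := isClosed_biInter fun l _ =>
    isClosed_eq (ee_cont_left l t0) continuous_const
  have ht0 : t0 ∈ P := (hPmem _).2 fun l _ => ee_self l t0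
  have hu0 : u0 ∈ P := (hPmem _).2 fun l hl => by rw [ee_comm]; exact hz l hl
  obtain ⟨tb, htb, hmax⟩ := hPc.isCompact.exists_isMaxOn ⟨t0, ht0⟩ f.continuous.continuousOn
  obtain ⟨ta, hta, hmin⟩ := hPc.isCompact.exists_isMinOn ⟨t0, ht0⟩ f.continuous.continuousOn
  set b := f tb with hb
  set a := f ta with ha
  have hmax' : ∀ t ∈ P, f t ≤ b := fun t ht => hmax ht
  have hmin' : ∀ t ∈ P, a ≤ f t := fun t ht => hmin ht
  have hab : 3 * ε ≤ b - a := by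
    refine hd.trans (abs_le.2 ⟨?_, ?_⟩)
    · linarith [hmax' u0 hu0, hmin' t0 ht0]
    · linarith [hmax' t0 ht0, hmin' u0 hu0]
  have hQb : IsClosed (P ∩ {t | f t = b}) :=
    hPc.inter (isClosed_eq f.continuous continuous_const)
  have hQa : IsClosed (P ∩ {t | f t = a}) :=
    hPc.inter (isClosed_eq f.continuous continuous_const)
  obtain ⟨i, J, M, V, hVo, hQV, hVD, hne, hM⟩ := S.exists_fin hQb ⟨tb, htb, rfl⟩
  obtain ⟨i', J', M', V', hVo', hQV', hVD', hne', hM'⟩ := S.exists_fin hQa ⟨ta, hta, rfl⟩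
  obtain ⟨l, hl, m, hm⟩ := cpt_aux (X := K) (R := Reach S f xr) (reach_nil S f xr)
    (fun l m => reach_append)
    (fun l m => {t | ee l t t0 ≤ 2 * (1 / ((m : ℝ) + 1))} ∩
      (({t | b - 1 / ((m : ℝ) + 1) ≤ f t} ∩ Vᶜ) ∪ ({t | f t ≤ a + 1 / ((m : ℝ) + 1)} ∩ V'ᶜ)))
    (fun l m => (isClosed_le (ee_cont_left l t0) continuous_const).inter
      (((isClosed_le continuous_const f.continuous).inter hVo.isClosed_compl).union
        ((isClosed_le f.continuous continuous_const).inter hVo'.isClosed_compl)))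
    (by
      rintro l l' m m' t ⟨h1, h2⟩
      have h1' : ee (l ++ l') t t0 ≤ 2 * (1 / (((max m m' : ℕ) : ℝ) + 1)) := h1
      rw [ee_append] at h1'
      obtain ⟨o1, o2⟩ := one_div_max_le m m'
      have n1 := ee_nonneg l t t0
      have n2 := ee_nonneg l' t t0
      have g1 : ee l t t0 ≤ 2 * (1 / ((m : ℝ) + 1)) := by linarith
      have g2 : ee l' t t0 ≤ 2 * (1 / ((m' : ℝ) + 1)) := by linarith
      rcases h2 with ⟨h2, h3⟩ | ⟨h2, h3⟩
      · have h2' : b - 1 / (((max m m' : ℕ) : ℝ) + 1) ≤ f t := h2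
        have k1 : b - 1 / ((m : ℝ) + 1) ≤ f t := by linarith
        have k2 : b - 1 / ((m' : ℝ) + 1) ≤ f t := by linarith
        exact ⟨⟨g1, Or.inl ⟨k1, h3⟩⟩, ⟨g2, Or.inl ⟨k2, h3⟩⟩⟩
      · have h2' : f t ≤ a + 1 / (((max m m' : ℕ) : ℝ) + 1) := h2
        have k1 : f t ≤ a + 1 / ((m : ℝ) + 1) := by linarith
        have k2 : f t ≤ a + 1 / ((m' : ℝ) + 1) := by linarith
        exact ⟨⟨g1, Or.inr ⟨k1, h3⟩⟩, ⟨g2, Or.inr ⟨k2, h3⟩⟩⟩)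
    (by
      intro t
      by_cases ht : t ∈ P
      · obtain ⟨m, hm1, hm2⟩ : ∃ m : ℕ, (t ∉ V → f t < b - 1 / ((m : ℝ) + 1)) ∧
            (t ∉ V' → a + 1 / ((m : ℝ) + 1) < f t) := by
          by_cases hV : f t = b
          · have hfa : 0 < f t - a := by linarith
            obtain ⟨m, hm⟩ := exists_nat_one_div_lt hfa
            exact ⟨m, fun h => absurd (hQV ⟨ht, hV⟩) h, fun _ => by linarith⟩
          · have hfb : 0 < b - f t := sub_pos.2 (lt_of_le_of_ne (hmax' t ht) hV)
            by_cases hV' : f t = a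
            · obtain ⟨m, hm⟩ := exists_nat_one_div_lt hfb
              exact ⟨m, fun _ => by linarith, fun h => absurd (hQV' ⟨ht, hV'⟩) h⟩
            · have hfa : 0 < f t - a := sub_pos.2 (lt_of_le_of_ne (hmin' t ht) (Ne.symm hV'))
              obtain ⟨m, hm⟩ := exists_nat_one_div_lt (lt_min hfb hfa)
              have h1 := min_le_left (b - f t) (f t - a)
              have h2 := min_le_right (b - f t) (f t - a)
              exact ⟨m, fun _ => by linarith, fun _ => by linarith⟩
        refine ⟨[], reach_nil S f xr, m, ?_⟩
        rintro ⟨-, ⟨h2, h3⟩ | ⟨h2, h3⟩⟩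
        · exact absurd h2 (not_le.2 (hm1 h3))
        · exact absurd h2 (not_le.2 (hm2 h3))
      · rw [hPmem] at ht
        push Not at ht
        obtain ⟨l, hl, hne⟩ := ht
        have hpos : 0 < ee l t t0 / 2 :=
          half_pos (lt_of_le_of_ne (ee_nonneg _ _ _) (Ne.symm hne))
        obtain ⟨m, hm⟩ := exists_nat_one_div_lt hpos
        refine ⟨l, hl, m, fun hmem => ?_⟩
        have h1 : ee l t t0 ≤ 2 * (1 / ((m : ℝ) + 1)) := hmem.1
        linarith)
  set δ : ℝ := 1 / ((m : ℝ) + 1) with hδ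
  have hδ0 : 0 < δ := by positivity
  have hVb : ∀ t, ee l t t0 ≤ 2 * δ → b - δ ≤ f t → t ∈ V := by
    intro t h1 h2
    by_contra h3
    have : t ∈ (∅ : Set K) := hm ▸ ⟨h1, Or.inl ⟨h2, h3⟩⟩
    exact this
  have hVa : ∀ t, ee l t t0 ≤ 2 * δ → f t ≤ a + δ → t ∈ V' := by
    intro t h1 h2
    by_contra h3
    have : t ∈ (∅ : Set K) := hm ▸ ⟨h1, Or.inr ⟨h2, h3⟩⟩
    exact this
  obtain ⟨n, hn⟩ := pt_spec l t0 hδ0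
  have hPC : ∀ t ∈ P, ee l t (pt l n) ≤ 1 / ((m : ℝ) + 1) := by
    intro t ht
    have h1 := (hPmem t).1 ht l hl
    have h2 := ee_tri l t t0 (pt l n)
    linarith
  have hCt : ∀ t, ee l t (pt l n) ≤ 1 / ((m : ℝ) + 1) → ee l t t0 ≤ 2 * δ := by
    intro t ht
    have h2 := ee_tri l t (pt l n) t0
    rw [ee_comm l (pt l n) t0] at h2
    linarith
  have hnb := (abs_le.1 (cm_abs_le f tb)).2
  have hna := (abs_le.1 (cm_abs_le f ta)).1
  obtain ⟨β, δ1, hδ1, g1, g2⟩ := vv_gap (Y := YY S l n m i J) (M := M) (f := f) (b := b) (δ := δ)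
    (by linarith) hδ0
    (by
      intro x hx
      obtain ⟨t, ⟨⟨htP, hfb⟩, hX⟩, hU⟩ := hM x hx
      exact ⟨t, ⟨hU, hX, hPC t htP⟩, hfb⟩)
    (by
      rintro x hx t ⟨hU, hX, hC⟩
      by_contra! hcon
      obtain ⟨y, hy, hyA, hyU⟩ := Set.mem_iUnion₂.1 (hVD ⟨hVb t (hCt t hC) hcon.le, hX⟩)
      exact hx (S.disj i x y t hyA hU hyU ▸ hy))
  obtain ⟨β', δ2, hδ2, g3, g4⟩ := vv_gap (Y := YY S l n m i' J') (M := M') (f := -f) (b := -a)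
    (δ := δ) (by rw [norm_neg]; linarith) hδ0
    (by
      intro x hx
      obtain ⟨t, ⟨⟨htP, hfb⟩, hX⟩, hU⟩ := hM' x hx
      refine ⟨t, ⟨hU, hX, hPC t htP⟩, ?_⟩
      have : f t = a := hfb
      simp [this])
    (by
      rintro x hx t ⟨hU, hX, hC⟩
      by_contra! hcon
      have hcon' : -a - δ < - f t := hcon
      obtain ⟨y, hy, hyA, hyU⟩ := Set.mem_iUnion₂.1
        (hVD' ⟨hVa t (hCt t hC) (by linarith), hX⟩)
      exact hx (S.disj i' x y t hyA hU hyU ▸ hy))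
  have hreach := reach_step hl n m i i' J J' M M' hδ1 hδ2 g1 g2 g3 g4
  have hex : ∃ h : C(K, ℝ), (∀ t ∈ S.D i M, h t = 1) ∧ ∀ t ∈ S.D i' M', h t = 0 := by
    obtain ⟨h, h0, h1, -⟩ := exists_continuous_zero_one_of_isClosed
      (s := {t | f t ≤ a + ε}) (t := {t | b - ε ≤ f t})
      (isClosed_le f.continuous continuous_const) (isClosed_le continuous_const f.continuous)
      (by
        rw [Set.disjoint_left]
        intro t h1 h2
        have h1' : f t ≤ a + ε := h1
        have h2' : b - ε ≤ f t := h2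
        linarith)
    refine ⟨h, fun t ht => ?_, fun t ht => ?_⟩
    · obtain ⟨x, hx, hA, hU⟩ := Set.mem_iUnion₂.1 ht
      obtain ⟨u, ⟨⟨-, hfb⟩, hX⟩, hU'⟩ := hM x hx
      have hfb' : f u = b := hfb
      have := (abs_le.1 (hf i x t u hA hU hX.1 hU')).1
      exact h1 (show b - ε ≤ f t by linarith)
    · obtain ⟨x, hx, hA, hU⟩ := Set.mem_iUnion₂.1 ht
      obtain ⟨u, ⟨⟨-, hfb⟩, hX⟩, hU'⟩ := hM' x hx
      have hfb' : f u = a := hfb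
      have := (abs_le.1 (hf i' x t u hA hU hX.1 hU')).2
      exact h0 (show f t ≤ a + ε by linarith)
  obtain ⟨s1, s0⟩ := hh_spec S i i' M M' hex
  obtain ⟨x, hxQ, hxX⟩ := hne
  obtain ⟨y, hyQ, hyX⟩ := hne'
  have e1 := s1 x (hVD ⟨hQV hxQ, hxX⟩)
  have e0 := s0 y (hVD' ⟨hQV' hyQ, hyX⟩)
  have z1 := (hPmem x).1 hxQ.1 _ hreach
  have z0 := (hPmem y).1 hyQ.1 _ hreach
  rw [ee_append] at z1 z0
  have w1 := ee_nonneg l x t0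
  have w0 := ee_nonneg l y t0
  have v1 := ee_nonneg [hh S i i' M M'] x t0
  have v0 := ee_nonneg [hh S i i' M M'] y t0
  have q1 : ee [hh S i i' M M'] x t0 = 0 := by linarith
  have q0 : ee [hh S i i' M M'] y t0 = 0 := by linarith
  simp only [ee, List.map_cons, List.map_nil, List.sum_cons, List.sum_nil, add_zero,
    abs_eq_zero, sub_eq_zero] at q1 q0
  rw [e1] at q1
  rw [e0, ← q1] at q0
  exact zero_ne_one q0

theorem df_ev (t : K) (f g : C(K, ℝ)) :
    df (fun f : C(K, ℝ) => |f t| ^ 2) f g = 1 / 4 * |f t - g t| ^ 2 := by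
  unfold df
  simp only [sq_abs, ContinuousMap.smul_apply, ContinuousMap.add_apply, smul_eq_mul]
  ring

theorem sys_main [Nonempty K] [T2Space K] (S : Sys K) :
    ∃ q : C(K, ℝ) → ℝ, QF q ∧ (∀ f, 1 / 2 * ‖f‖ ^ 2 ≤ q f) ∧
      ∀ f : C(K, ℝ), ∀ ε : ℝ, 0 < ε →
      (∀ i x t u, t ∈ S.A i → t ∈ S.U i x → u ∈ S.A i → u ∈ S.U i x → |f t - f u| ≤ ε) →
      ∀ xr : ℕ → C(K, ℝ), Tendsto (fun r => df q f (xr r)) atTop (𝓝 0) →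
      ∀ᶠ r in atTop, ‖f - xr r‖ ≤ 9 * ε := by
  have hQ := QF.csum fun s : ℕ => QF_NN S s []
  refine ⟨fun f => 1 / 2 * ‖f‖ ^ 2 + 1 / 2 * csum (fun s => NN S s []) f,
    QF_norm.comb hQ (by norm_num) (by norm_num) (by norm_num),
    fun f => by have := hQ.nonneg f; linarith, ?_⟩
  intro f ε hε hf xr ht
  have ht1 : Tendsto (fun r => df (csum (fun s => NN S s [])) f (xr r)) atTop (𝓝 0) := by
    have h2 := ht.const_mul 2
    rw [mul_zero] at h2
    refine squeeze_zero (fun r => hQ.df_nonneg _ _) (fun r => ?_) h2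
    have h3 := df_comb (fun f : C(K, ℝ) => ‖f‖ ^ 2) (csum (fun s => NN S s [])) (1 / 2) (1 / 2)
      f (xr r)
    have h4 := QF_norm.df_nonneg f (xr r)
    linarith
  have hgood : Good_s3 S f xr [] := fun s => tendsto_df_csum (fun s => QF_NN S s []) s ht1
  obtain ⟨l, hl, m, hosc⟩ := exists_osc S f xr hε hf
  have hgl : Good_s3 S f xr l := by simpa using hl [] hgood
  have h0 := hgl 0
  -- pointwise convergence
  have hpt : ∀ n, ∀ᶠ r in atTop, |f (pt l n) - xr r (pt l n)| ≤ ε := by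
    intro n
    have h1 := tendsto_df_csum (QF_NN0 l) (Sum.inl n) h0
    have h2 : ∀ᶠ r in atTop, df (fun f : C(K, ℝ) => |f (pt l n)| ^ 2) f (xr r) < 1 / 4 * ε ^ 2 :=
      h1.eventually (gt_mem_nhds (by positivity))
    filter_upwards [h2] with r hr
    rw [df_ev, sq_abs] at hr
    exact abs_le_of_sq_le_sq (by linarith) hε.le
  -- oscillation
  have hos : ∀ᶠ r in atTop, ∀ t u, ee l t u ≤ 1 / ((m : ℝ) + 1) → |xr r t - xr r u| ≤ 5 * ε := by
    have h1 := tendsto_df_csum (QF_NN0 l) (Sum.inr m) h0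
    have h2 : ∀ᶠ r in atTop, df (osc l m) f (xr r) < 1 / 4 * ε ^ 2 :=
      h1.eventually (gt_mem_nhds (by positivity))
    filter_upwards [h2] with r hr t u htu
    have h3 := (QF_osc l m).df_ge f (xr r)
    have h4 : |√(osc l m f) - √(osc l m (xr r))| ≤ ε :=
      abs_le_of_sq_le_sq (by linarith) hε.le
    have h5 : osc l m f ≤ (3 * ε / 2) ^ 2 := by
      refine Real.iSup_le (fun p => ?_) (by positivity)
      have := hosc p.1.1 p.1.2 p.2
      gcongr
    have h6 : √(osc l m f) ≤ 3 * ε / 2 := Real.sqrt_le_iff.2 ⟨by positivity, h5⟩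
    have h7 : (|xr r t - xr r u| / 2) ^ 2 ≤ osc l m (xr r) :=
      QF.le_iSup (q := fun (p : {p : K × K // ee l p.1 p.2 ≤ 1 / ((m : ℝ) + 1)})
        (f : C(K, ℝ)) => (|f p.1.1 - f p.1.2| / 2) ^ 2)
        (fun p => QF_pair p.1.1 p.1.2) ⟨(t, u), htu⟩ (xr r)
    have h8 : |xr r t - xr r u| / 2 ≤ √(osc l m (xr r)) := Real.le_sqrt_of_sq_le h7
    have h9 := (abs_le.1 h4).1
    linarith
  -- finite net
  have hη : (0 : ℝ) < 1 / ((m : ℝ) + 1) := by positivity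
  obtain ⟨F, hF⟩ := isCompact_univ.elim_finite_subcover
    (fun n : ℕ => {t | ee l t (pt l n) < 1 / ((m : ℝ) + 1)})
    (fun n => isOpen_lt (ee_cont_left l _) continuous_const)
    (fun t _ => by
      obtain ⟨n, hn⟩ := pt_spec l t hη
      exact Set.mem_iUnion.2 ⟨n, hn⟩)
  have hall : ∀ᶠ r in atTop, ∀ n ∈ F, |f (pt l n) - xr r (pt l n)| ≤ ε :=
    (Filter.eventually_all_finset F).2 fun n _ => hpt n
  filter_upwards [hos, hall] with r h1 h2
  rw [ContinuousMap.norm_le _ (by positivity)]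
  intro t
  obtain ⟨n, hn, hnt⟩ := Set.mem_iUnion₂.1 (hF (Set.mem_univ t))
  have hnt' : ee l t (pt l n) < 1 / ((m : ℝ) + 1) := hnt
  have a1 := abs_le.1 (hosc t (pt l n) hnt'.le)
  have a2 := abs_le.1 (h1 t (pt l n) hnt'.le)
  have a3 := abs_le.1 (h2 n hn)
  rw [Real.norm_eq_abs, ContinuousMap.sub_apply, abs_le]
  constructor <;> linarith [a1.1, a1.2, a2.1, a2.2, a3.1, a3.2]

theorem exists_sys {K : Type*} [T : TopologicalSpace K] (d : K → K → ℝ) (hmet : IsMetricOn K d)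
    (hP : PropertyP T d) (ε : ℝ) (hε : 0 < ε) :
    ∃ S : Sys K, ∀ i x t, t ∈ S.A i → t ∈ S.U i x → t ∈ closure {y | d x y < ε} := by
  classical
  obtain ⟨B, hB⟩ := hP
  have hsymm := hmet.symm
  have htri := hmet.triangle
  -- local form of property P
  have hloc : ∀ (x : K) (η : ℝ), 0 < η → ∃ (J : Finset ℕ) (U : Set K), IsOpen U ∧ x ∈ U ∧
      (∀ j ∈ J, x ∈ B j) ∧ ∀ y ∈ U, (∀ j ∈ J, y ∈ B j) → d x y < η := by
    intro x η hη
    have hopen : IsOpen[TopologicalSpace.generateFrom ({U | T.IsOpen U} ∪ Set.range B)]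
        {y | d x y < η} := by
      apply hB
      exact TopologicalSpace.isOpen_generateFrom_of_mem ⟨x, η, hη, rfl⟩
    have gen : ∀ V : Set K,
        TopologicalSpace.GenerateOpen ({U | T.IsOpen U} ∪ Set.range B) V → x ∈ V →
        ∃ (J : Finset ℕ) (U : Set K), IsOpen U ∧ x ∈ U ∧
          (∀ j ∈ J, x ∈ B j) ∧ ∀ y ∈ U, (∀ j ∈ J, y ∈ B j) → y ∈ V := by
      intro V hV
      induction hV with
      | basic s hs =>
        intro hx
        rcases hs with hs | ⟨n, rfl⟩
        · exact ⟨∅, s, hs, hx, by simp, fun y hy _ => hy⟩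
        · exact ⟨{n}, Set.univ, isOpen_univ, trivial, by simpa using hx,
            fun y _ hy => hy n (by simp)⟩
      | univ => intro _; exact ⟨∅, Set.univ, isOpen_univ, trivial, by simp, fun y _ _ => trivial⟩
      | inter s t _ _ ihs iht =>
        rintro ⟨hxs, hxt⟩
        obtain ⟨J1, U1, a1, b1, c1, e1⟩ := ihs hxs
        obtain ⟨J2, U2, a2, b2, c2, e2⟩ := iht hxt
        refine ⟨J1 ∪ J2, U1 ∩ U2, a1.inter a2, ⟨b1, b2⟩, ?_, ?_⟩
        · intro j hj
          rcases Finset.mem_union.1 hj with h | h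
          · exact c1 j h
          · exact c2 j h
        · rintro y ⟨hy1, hy2⟩ hy
          exact ⟨e1 y hy1 fun j hj => hy j (Finset.mem_union_left _ hj),
            e2 y hy2 fun j hj => hy j (Finset.mem_union_right _ hj)⟩
      | sUnion S _ ih =>
        rintro ⟨s, hs, hxs⟩
        obtain ⟨J, U, a, b, c, e⟩ := ih s hs hxs
        exact ⟨J, U, a, b, c, fun y hy hj => ⟨s, hs, e y hy hj⟩⟩
    exact gen _ hopen (show d x x < η by rw [hmet.self_eq_zero]; exact hη)
  -- the sets E
  let E : ℕ → Finset ℕ → Set K := fun n J => {x | (∀ j ∈ J, x ∈ B j) ∧ ∃ U : Set K, IsOpen U ∧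
    x ∈ U ∧ ∀ y ∈ U, (∀ j ∈ J, y ∈ B j) → d x y < 1 / ((n : ℝ) + 1)}
  obtain ⟨r, hr⟩ := exists_wellFoundedLT K
  -- discrete families
  let W : ℕ → Finset ℕ → K → Set K := fun n J x =>
    {y | y ∈ E n J ∧ d x y ≤ ε - 1 / ((n : ℝ) + 1) ∧ ∀ z, z < x → ε ≤ d z y}
  have hsep : ∀ n J x x', x ≠ x' → ∀ y ∈ W n J x, ∀ y' ∈ W n J x', 1 / ((n : ℝ) + 1) ≤ d y y' := by
    have key : ∀ n J x x', x < x' → ∀ y ∈ W n J x, ∀ y' ∈ W n J x',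
        1 / ((n : ℝ) + 1) ≤ d y y' := by
      intro n J x x' hlt y hy y' hy'
      have h1 := hy.2.1
      have h2 := hy'.2.2 x hlt
      have h3 := htri x y y'
      linarith
    intro n J x x' hne y hy y' hy'
    rcases lt_or_gt_of_ne hne with h | h
    · exact key n J x x' h y hy y' hy'
    · rw [hsymm]; exact key n J x' x h y' hy' y hy
  let U : ℕ → Finset ℕ → K → Set K := fun n J x =>
    ⋃₀ {O | IsOpen O ∧ ∀ x', ∀ y ∈ O, y ∈ W n J x' → x' = x}
  have hUo : ∀ n J x, IsOpen (U n J x) := fun n J x => isOpen_sUnion fun O hO => hO.1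
  have hUW : ∀ n J x x' y, y ∈ U n J x → y ∈ W n J x' → x' = x := by
    rintro n J x x' y ⟨O, hO, hy⟩ hW
    exact hO.2 x' y hy hW
  have hWU : ∀ n J x, W n J x ⊆ U n J x := by
    intro n J x y hy
    obtain ⟨hyB, O, hO, hyO, hO'⟩ := hy.1
    refine ⟨O, ⟨hO, fun x' y' hy'O hy' => ?_⟩, hyO⟩
    by_contra hne
    have h1 := hsep n J x x' (Ne.symm hne) y hy y' hy'
    have h2 := hO' y' hy'O hy'.1.1
    linarith
  obtain ⟨g, hg⟩ := exists_surjective_nat (ℕ × Finset ℕ)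
  let A' : ℕ → Finset ℕ → Set K := fun n J => closure (⋃ x, W n J x)
  have hsub : ∀ n J x O, IsOpen O → O ⊆ U n J x → ∀ t ∈ A' n J, t ∈ O →
      ∃ y ∈ O, y ∈ W n J x := by
    intro n J x O hO hOU t ht htO
    obtain ⟨y, hyO, hy⟩ := mem_closure_iff.1 ht O hO htO
    obtain ⟨x', hx'⟩ := Set.mem_iUnion.1 hy
    obtain rfl := hUW n J x x' y (hOU hyO) hx'
    exact ⟨y, hyO, hx'⟩
  refine ⟨⟨fun i => A' (g i).1 (g i).2, fun i x => U (g i).1 (g i).2 x, fun i => isClosed_closure,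
    fun i x => hUo _ _ _, ?_, ?_⟩, ?_⟩
  · intro i x y t htA htx hty
    obtain ⟨z, hz, hzW⟩ := hsub _ _ x _ ((hUo (g i).1 (g i).2 x).inter (hUo (g i).1 (g i).2 y))
      Set.inter_subset_left t htA ⟨htx, hty⟩
    exact hUW _ _ y x z hz.2 hzW
  · intro t
    have hwf : WellFounded (fun a b : K => a < b) := wellFounded_lt
    have hne : {x : K | d x t < ε}.Nonempty := ⟨t, by simpa [hmet.self_eq_zero] using hε⟩
    let x := hwf.min _ hne
    have hx : d x t < ε := hwf.min_mem _ hne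
    obtain ⟨n, hn⟩ := exists_nat_one_div_lt (sub_pos.2 hx)
    obtain ⟨J, O, h1, h2, h3, h4⟩ := hloc t (1 / ((n : ℝ) + 1)) (by positivity)
    obtain ⟨i, hi⟩ := hg (n, J)
    have htW : t ∈ W n J x := by
      refine ⟨⟨h3, O, h1, h2, h4⟩, by linarith, fun z hz => ?_⟩
      by_contra! hlt
      exact hwf.not_lt_min _ hlt hz
    refine ⟨i, x, ?_, ?_⟩
    · simp only [hi]; exact subset_closure (Set.mem_iUnion.2 ⟨x, htW⟩)
    · simp only [hi]; exact hWU _ _ _ htW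
  · intro i x t htA htU
    rw [mem_closure_iff]
    intro O hO htO
    obtain ⟨y, hyO, hyW⟩ := hsub _ _ x _ ((hUo (g i).1 (g i).2 x).inter hO)
      Set.inter_subset_left t htA ⟨htU, htO⟩
    refine ⟨y, hyO.2, ?_⟩
    have h1 := hyW.2.1
    have h2 : (0 : ℝ) < 1 / (((g i).1 : ℝ) + 1) := by positivity
    show d x y < ε
    linarith

end TC

/-- Theorem C: if `(K,T)` is a compact Hausdorff space with property `P(d,T)` for a
metric `d`, then `C(K)` admits a norm, equivalent to the supremum norm, which is
locally uniformly rotund at every `f ∈ C(K)` which is `d`-uniformly continuous. -/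
theorem theoremC {K : Type*} [TopologicalSpace K] [CompactSpace K] [T2Space K]
    (d : K → K → ℝ) (hmet : IsMetricOn K d)
    (hfiner : metricTopology d ≤ ‹TopologicalSpace K›)
    (hP : PropertyP ‹TopologicalSpace K› d) :
    ∃ N : C(K, ℝ) → ℝ, IsNorm N ∧
      (∃ c C : ℝ, 0 < c ∧ c ≤ C ∧ ∀ f : C(K, ℝ), c * ‖f‖ ≤ N f ∧ N f ≤ C * ‖f‖) ∧
      ∀ f : C(K, ℝ),
        (∀ ε : ℝ, 0 < ε → ∃ δ : ℝ, 0 < δ ∧ ∀ t u : K, d t u ≤ δ → |f t - f u| ≤ ε) →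
        LURAt N f := by
  rcases isEmpty_or_nonempty K with hK | hK
  · have hsub : Subsingleton C(K, ℝ) := ⟨fun f g => by ext t; exact hK.elim t⟩
    refine ⟨fun f => ‖f‖, ⟨fun z => norm_nonneg z, fun z _ => Subsingleton.elim _ _,
      fun c z => by show ‖c • z‖ = |c| * ‖z‖; rw [norm_smul, Real.norm_eq_abs], fun z w => norm_add_le z w⟩,
      ⟨1, 1, one_pos, le_rfl, fun f => by simp⟩, fun f _ xr _ => ?_⟩
    have : (fun r => ‖f - xr r‖) = fun _ => 0 := by
      ext r
      rw [Subsingleton.elim f (xr r), sub_self, norm_zero]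
    rw [this]
    exact tendsto_const_nhds
  choose S hS using fun k : ℕ => exists_sys d hmet hP (1 / ((k : ℝ) + 1)) (by positivity)
  choose q hq hlow hlur using fun k : ℕ => sys_main (S k)
  have hQ := QF.csum hq
  have hQs : QF (fun f => 1 / 2 * csum q f + 1 / 2 * csum q (-f)) :=
    hQ.comb hQ.neg (by norm_num) (by norm_num) (by norm_num)
  set p : C(K, ℝ) → ℝ := fun f => 1 / 2 * csum q f + 1 / 2 * csum q (-f) with hp
  have heven : ∀ f, p (-f) = p f := by
    intro f; simp only [hp, neg_neg]; ring
  have hsm : ∀ (c : ℝ) f, p (c • f) = c ^ 2 * p f := by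
    intro c f
    rcases le_total 0 c with hc | hc
    · exact hQs.smul c f hc
    · rw [← heven, ← neg_smul, hQs.smul _ _ (by linarith)]; ring
  set w := wt ℕ 0 with hw
  have hw0 : 0 < w := wt_pos 0
  have hlb : ∀ f, w / 4 * ‖f‖ ^ 2 ≤ p f := by
    intro f
    have h1 := le_csum hq 0 f
    have h2 := hQ.nonneg (-f)
    have h3 := mul_le_mul_of_nonneg_left (hlow 0 f) hw0.le
    simp only [hp]
    linarith
  have hlb' : ∀ f, √(w / 4) * ‖f‖ ≤ √(p f) := by
    intro f
    refine Real.le_sqrt_of_sq_le ?_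
    rw [mul_pow, Real.sq_sqrt (by positivity)]
    exact hlb f
  have hub : ∀ f, √(p f) ≤ ‖f‖ := fun f => Real.sqrt_le_iff.2 ⟨norm_nonneg _, hQs.le f⟩
  have hs0 : 0 < √(w / 4) := Real.sqrt_pos.2 (by positivity)
  refine ⟨fun f => √(p f), ⟨fun f => Real.sqrt_nonneg _, fun f hf => ?_, fun c f => ?_,
    fun f g => hQs.sqrt_add f g⟩, ⟨min (√(w / 4)) 1, 1, lt_min hs0 one_pos, min_le_right _ _,
    fun f => ⟨?_, by simpa using hub f⟩⟩, ?_⟩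
  · have h1 := hlb' f
    simp only at hf
    rw [hf] at h1
    have h2 : ‖f‖ ≤ 0 := by
      by_contra! h
      have := mul_pos hs0 h
      linarith
    exact norm_le_zero_iff.1 h2
  · simp only
    rw [hsm, Real.sqrt_mul (sq_nonneg c), Real.sqrt_sq_eq_abs]
  · exact (mul_le_mul_of_nonneg_right (min_le_left _ _) (norm_nonneg f)).trans (hlb' f)
  intro f hf xr hxr
  have hdf : Tendsto (fun r => df p f (xr r)) atTop (𝓝 0) := by
    refine hxr.congr fun r => ?_
    rw [Real.sq_sqrt (hQs.nonneg _), Real.sq_sqrt (hQs.nonneg _), Real.sq_sqrt (hQs.nonneg _)]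
    rfl
  have hdc : Tendsto (fun r => df (csum q) f (xr r)) atTop (𝓝 0) := by
    have h2 := hdf.const_mul 2
    rw [mul_zero] at h2
    refine squeeze_zero (fun r => hQ.df_nonneg _ _) (fun r => ?_) h2
    have h3 : df p f (xr r) = _ := df_comb (csum q) (fun f => csum q (-f)) (1 / 2) (1 / 2) f (xr r)
    have h4 := hQ.neg.df_nonneg f (xr r)
    linarith
  have hnorm : Tendsto (fun r => ‖f - xr r‖) atTop (𝓝 0) := by
    rw [Metric.tendsto_nhds]
    intro η hη
    obtain ⟨δ, hδ, hfδ⟩ := hf (η / 40) (by positivity)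
    obtain ⟨k, hk⟩ := exists_nat_one_div_lt hδ
    have h1 := hlur k f (η / 20) (by positivity) (by
      intro i x t u htA htU huA huU
      have key : ∀ t, t ∈ (S k).A i → t ∈ (S k).U i x → |f x - f t| ≤ η / 40 := by
        intro t htA htU
        have hcl : IsClosed {t | |f x - f t| ≤ η / 40} :=
          isClosed_le (by fun_prop) continuous_const
        refine closure_minimal ?_ hcl (hS k i x t htA htU)
        intro y hy
        have hy' : d x y < 1 / ((k : ℝ) + 1) := hy
        exact hfδ x y (by linarith)
      have k1 := abs_le.1 (key t htA htU)
      have k2 := abs_le.1 (key u huA huU)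
      rw [abs_le]
      constructor <;> linarith [k1.1, k1.2, k2.1, k2.2]) xr (tendsto_df_csum hq k hdc)
    filter_upwards [h1] with r hr
    rw [Real.dist_eq, sub_zero, abs_of_nonneg (norm_nonneg _)]
    linarith
  exact squeeze_zero (fun r => Real.sqrt_nonneg _) (fun r => hub _) hnorm
end
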